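/- arXiv:2004.03795 — 2 statements merged into one kernel-verified Lean document; each statement's English description precedes it below -/
import Mathlib

section
/- (Stationary ergodic weights: the pressure exists and is deterministic.) Let (Ω, ℱ, P) be a probability space, Θ: Ω → Ω a measure-preserving ergodic transformation, and W: Ω → ℝ a bounded measurable function; set ω_k = W(Θ^k ω). Let f: X → ℝ be of bounded variation. Then there exists a convex function φ̃: ℝ → ℝ such that for P-almost every ω ∈ Ω and every λ ∈ ℝ, the limit lim_{n→∞} (1/n) log ∫_X exp(λ Σ_{k=0}^{n−1} W(Θ^k ω) f(T^k x)) dσ(x) exists and equals φ̃(λ); in particular the pressure is independent of ω. -/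
open MeasureTheory Filter Finset
open scoped ENNReal Topology

noncomputable section

/-- The shift map `T` on `ℕ → S`, `(Tx)_n = x_{n+1}`. -/
def shift {S : Type*} (x : ℕ → S) : ℕ → S := fun n => x (n + 1)

/-- The cylinder `[a_0, …, a_{m-1}]` of all `y` with `y_i = a_i` for `0 ≤ i < m`. -/
def cyl {S : Type*} {m : ℕ} (a : Fin m → S) : Set (ℕ → S) :=
  {y : ℕ → S | ∀ i : Fin m, y i = a i}

/-- The partial weighted Birkhoff sum `S_{m,n} f(x) = ∑_{k=m}^{n-1} f_k(T^k x)`. -/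
def birk {S : Type*} (f : ℕ → (ℕ → S) → ℝ) (m n : ℕ) (x : ℕ → S) : ℝ :=
  ∑ k ∈ Finset.Ico m n, f k (shift^[k] x)

/-- The partition function `Z_{m,n}(λ) = ∫ exp(λ S_{m,n}f) dσ`. -/
def Zmn {S : Type*} [MeasurableSpace S] (σ : Measure (ℕ → S))
    (f : ℕ → (ℕ → S) → ℝ) (lam : ℝ) (m n : ℕ) : ℝ :=
  ∫ x, Real.exp (lam * birk f m n x) ∂σ

/-- Hypothesis (H2): uniformly bounded distortion. -/
def H2 {S : Type*} (f : ℕ → (ℕ → S) → ℝ) (D : ℝ) : Prop :=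
  ∀ N : ℕ, 1 ≤ N → ∀ x y : ℕ → S, (∀ i, i < N → x i = y i) →
    ∑ k ∈ Finset.range N, |f k (shift^[k] x) - f k (shift^[k] y)| ≤ D


/-- Running maximum of the Birkhoff sums. -/
def maxB {Ω : Type*} (Θ : Ω → Ω) (g : Ω → ℝ) : ℕ → Ω → ℝ
  | 0 => fun _ => 0
  | n + 1 => fun ω => max 0 (g ω + maxB Θ g n (Θ ω))

lemma maxB_nonneg {Ω : Type*} (Θ : Ω → Ω) (g : Ω → ℝ) (n : ℕ) (ω : Ω) : 0 ≤ maxB Θ g n ω := by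
  cases n with
  | zero => exact le_refl _
  | succ n => exact le_max_left _ _

lemma maxB_mono {Ω : Type*} (Θ : Ω → Ω) (g : Ω → ℝ) (n : ℕ) (ω : Ω) :
    maxB Θ g n ω ≤ maxB Θ g (n + 1) ω := by
  induction n generalizing ω with
  | zero => exact le_max_left _ _
  | succ n ih => exact max_le_max le_rfl (add_le_add le_rfl (ih _))

lemma sum_le_maxB {Ω : Type*} (Θ : Ω → Ω) (g : Ω → ℝ) (n : ℕ) (ω : Ω) :
    ∑ k ∈ Finset.range n, g (Θ^[k] ω) ≤ maxB Θ g n ω := by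
  induction n generalizing ω with
  | zero => simp [maxB]
  | succ n ih =>
    rw [Finset.sum_range_succ']
    refine le_trans ?_ (le_max_right _ _)
    have := ih (Θ ω)
    simp only [Function.iterate_succ, Function.comp, Function.iterate_zero, id]
    linarith

lemma maxB_meas {Ω : Type*} [MeasurableSpace Ω] (Θ : Ω → Ω) (hΘ : Measurable Θ)
    (g : Ω → ℝ) (hg : Measurable g) (n : ℕ) : Measurable (maxB Θ g n) := by
  induction n with
  | zero => exact measurable_const
  | succ n ih => exact measurable_const.max (hg.add (ih.comp hΘ))

lemma maxB_bdd {Ω : Type*} (Θ : Ω → Ω) (g : Ω → ℝ) (B : ℝ) (hB : ∀ ω, |g ω| ≤ B) (n : ℕ) (ω : Ω) :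
    maxB Θ g n ω ≤ n * B := by
  have hB0 : 0 ≤ B := (abs_nonneg _).trans (hB ω)
  induction n generalizing ω with
  | zero => simp [maxB]
  | succ n ih =>
    refine max_le (by positivity) ?_
    have := ih (Θ ω)
    have := (abs_le.1 (hB ω)).2
    push_cast
    linarith

lemma birkhoff_bdd {Ω : Type*} [MeasurableSpace Ω] (P : Measure Ω) [IsProbabilityMeasure P]
    (Θ : Ω → Ω) (hΘ : Ergodic Θ P) (g : Ω → ℝ) (hg : Measurable g) (B : ℝ)
    (hB : ∀ ω, |g ω| ≤ B) (hneg : ∫ ω, g ω ∂P < 0) :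
    ∀ᵐ ω ∂P, ∃ c : ℝ, ∀ n, ∑ k ∈ Finset.range n, g (Θ^[k] ω) ≤ c := by
  have hΘm := hΘ.measurable
  have hmm := maxB_meas Θ hΘm g hg
  let E : Set Ω := {ω | ∀ c : ℕ, ∃ n, (c : ℝ) < maxB Θ g n ω}
  have hEm : MeasurableSet E := by
    have : E = ⋂ c : ℕ, ⋃ n : ℕ, {ω | (c : ℝ) < maxB Θ g n ω} := by
      ext ω; simp [E]
    rw [this]
    exact MeasurableSet.iInter fun c => MeasurableSet.iUnion fun n =>
      measurableSet_lt measurable_const (hmm n)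
  have hEinv : Θ ⁻¹' E = E := by
    ext ω
    constructor
    · intro h c
      obtain ⟨d, hd⟩ := exists_nat_ge ((c : ℝ) + B)
      obtain ⟨n, hn⟩ := h d
      refine ⟨n + 1, lt_of_lt_of_le ?_ (le_max_right _ _)⟩
      have := (abs_le.1 (hB ω)).1
      linarith
    · intro h c
      obtain ⟨d, hd⟩ := exists_nat_ge ((c : ℝ) + B)
      obtain ⟨n, hn⟩ := h d
      have hn := hn.trans_le (maxB_mono Θ g n ω)
      refine ⟨n, ?_⟩
      have := (abs_le.1 (hB ω)).2
      have hB0 : 0 ≤ B := (abs_nonneg _).trans (hB ω)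
      have hc : (0 : ℝ) ≤ c := Nat.cast_nonneg c
      rcases lt_max_iff.1 hn with h1 | h1 <;> linarith
  rcases hΘ.toPreErgodic.ae_mem_or_ae_notMem hEm hEinv with h | h
  · exfalso
    have hint : ∀ n, Integrable (maxB Θ g n) P := fun n =>
      Integrable.of_bound (hmm n).aestronglyMeasurable (n * B) (ae_of_all _ fun ω => by
        rw [Real.norm_eq_abs, abs_of_nonneg (maxB_nonneg Θ g n ω)]
        exact maxB_bdd Θ g B hB n ω)
    have hint' : ∀ n, Integrable (fun ω => maxB Θ g n (Θ ω)) P := fun n =>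
      (hΘ.toMeasurePreserving.integrable_comp (hmm n).aestronglyMeasurable).2 (hint n)
    have hlim : Tendsto (fun n => ∫ ω, (maxB Θ g (n + 1) ω - maxB Θ g n (Θ ω)) ∂P) atTop
        (𝓝 (∫ ω, g ω ∂P)) := by
      refine tendsto_integral_of_dominated_convergence (fun _ => B) ?_ (integrable_const _) ?_ ?_
      · intro n
        exact ((hmm (n + 1)).sub ((hmm n).comp hΘm)).aestronglyMeasurable
      · intro n
        refine ae_of_all _ fun ω => ?_
        have h0 := maxB_nonneg Θ g n (Θ ω)
        have hb := abs_le.1 (hB ω)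
        have hB0 : 0 ≤ B := (abs_nonneg _).trans (hB ω)
        rw [Real.norm_eq_abs, abs_le]
        change -B ≤ max 0 (g ω + maxB Θ g n (Θ ω)) - _ ∧ max 0 (g ω + maxB Θ g n (Θ ω)) - _ ≤ B
        constructor
        · have := le_max_right 0 (g ω + maxB Θ g n (Θ ω)); linarith [hb.1]
        · have : max 0 (g ω + maxB Θ g n (Θ ω)) ≤ B + maxB Θ g n (Θ ω) :=
            max_le (by linarith) (by linarith [hb.2])
          linarith
      · filter_upwards [h] with ω hω
        have hω' : Θ ω ∈ E := by rw [← hEinv] at hω; exact hω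
        obtain ⟨d, hd⟩ := exists_nat_ge B
        obtain ⟨N, hN⟩ := hω' d
        refine tendsto_const_nhds.congr' ?_
        filter_upwards [eventually_ge_atTop N] with n hn
        have h1 : maxB Θ g N (Θ ω) ≤ maxB Θ g n (Θ ω) :=
          monotone_nat_of_le_succ (fun n => maxB_mono Θ g n (Θ ω)) hn
        change g ω = max 0 (g ω + maxB Θ g n (Θ ω)) - _
        rw [max_eq_right]
        · ring
        · have := (abs_le.1 (hB ω)).1; linarith
    have hge : 0 ≤ ∫ ω, g ω ∂P := by
      refine ge_of_tendsto' hlim fun n => ?_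
      rw [integral_sub (hint _) (hint' _)]
      have : ∫ ω, maxB Θ g n (Θ ω) ∂P = ∫ ω, maxB Θ g n ω ∂P := by
        have h1 := integral_map (μ := P) hΘm.aemeasurable
          (f := maxB Θ g n) (hmm n).aestronglyMeasurable
        rw [hΘ.toMeasurePreserving.map_eq] at h1
        exact h1.symm
      rw [this, sub_nonneg]
      exact integral_mono (hint _) (hint _) fun ω => maxB_mono Θ g n ω
    linarith
  · filter_upwards [h] with ω hω
    simp only [E, Set.mem_ofPred_eq, not_forall, not_exists, not_lt] at hω
    obtain ⟨c, hc⟩ := hω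
    exact ⟨c, fun n => (sum_le_maxB Θ g n ω).trans (hc n)⟩

/-- One-sided pointwise ergodic theorem, bounded case. -/
lemma birkhoff_upper {Ω : Type*} [MeasurableSpace Ω] (P : Measure Ω) [IsProbabilityMeasure P]
    (Θ : Ω → Ω) (hΘ : Ergodic Θ P) (g : Ω → ℝ) (hg : Measurable g) (B : ℝ)
    (hB : ∀ ω, |g ω| ≤ B) (ε : ℝ) (hε : 0 < ε) :
    ∀ᵐ ω ∂P, ∀ᶠ n : ℕ in atTop,
      ∑ k ∈ Finset.range n, g (Θ^[k] ω) ≤ n * (∫ ω, g ω ∂P + ε) := by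
  have hgi : Integrable g P := Integrable.of_bound hg.aestronglyMeasurable B
    (ae_of_all _ fun ω => by simpa using hB ω)
  set I := ∫ ω, g ω ∂P with hI
  have := birkhoff_bdd P Θ hΘ (fun ω => g ω - (I + ε / 2)) (hg.sub_const _) (B + |I + ε / 2|)
    (fun ω => (abs_sub _ _).trans (add_le_add (hB ω) le_rfl))
    (by rw [integral_sub hgi (integrable_const _)]; simp [← hI]; linarith)
  filter_upwards [this] with ω ⟨c, hc⟩
  obtain ⟨N, hN⟩ := exists_nat_ge (c / (ε / 2))
  filter_upwards [eventually_ge_atTop N] with n hn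
  have h1 := hc n
  rw [Finset.sum_sub_distrib] at h1
  simp only [Finset.sum_const, Finset.card_range, nsmul_eq_mul] at h1
  have h2 : c ≤ n * (ε / 2) := by
    have : c / (ε / 2) ≤ n := hN.trans (by exact_mod_cast hn)
    rwa [div_le_iff₀ (by positivity)] at this
  linarith

lemma birkhoff_two {Ω : Type*} [MeasurableSpace Ω] (P : Measure Ω) [IsProbabilityMeasure P]
    (Θ : Ω → Ω) (hΘ : Ergodic Θ P) (g : Ω → ℝ) (hg : Measurable g) (B : ℝ)
    (hB : ∀ ω, |g ω| ≤ B) (ε : ℝ) (hε : 0 < ε) :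
    ∀ᵐ ω ∂P, ∀ᶠ n : ℕ in atTop,
      |∑ k ∈ Finset.range n, g (Θ^[k] ω) - n * ∫ ω, g ω ∂P| ≤ n * ε := by
  filter_upwards [birkhoff_upper P Θ hΘ g hg B hB ε hε,
    birkhoff_upper P Θ hΘ (fun ω => - g ω) hg.neg B (by simpa using hB) ε hε] with ω h1 h2
  filter_upwards [h1, h2] with n h1 h2
  rw [integral_neg, Finset.sum_neg_distrib] at h2
  rw [abs_le]
  constructor <;> linarith

/-- Convergence for almost additive sequences. -/
lemma almost_additive {Ω : Type*} [MeasurableSpace Ω] (P : Measure Ω) [IsProbabilityMeasure P]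
    (Θ : Ω → Ω) (hΘ : Ergodic Θ P) (F : ℕ → Ω → ℝ) (hF : ∀ n, Measurable (F n)) (K C : ℝ)
    (hK : ∀ n ω, |F n ω| ≤ n * K)
    (hC : ∀ m n ω, |F (m + n) ω - F m ω - F n (Θ^[m] ω)| ≤ C) :
    ∃ L : ℝ, ∀ᵐ ω ∂P, Tendsto (fun n : ℕ => F n ω / n) atTop (𝓝 L) := by
  have hC0 : 0 ≤ C := by
    obtain ⟨ω⟩ : Nonempty Ω := P.nonempty_of_neZero
    exact (abs_nonneg _).trans (hC 0 0 ω)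
  have hK0 : 0 ≤ K := by
    obtain ⟨ω⟩ : Nonempty Ω := P.nonempty_of_neZero
    simpa using (abs_nonneg _).trans (hK 1 ω)
  have key : ∀ m n ω, |∑ j ∈ Finset.range n, F m (Θ^[j] ω) - m * F n ω|
      ≤ n * C + m * (C + 2 * m * K) := by
    intro m n ω
    have h1 : |∑ j ∈ Finset.range n, (F m (Θ^[j] ω) - (F (j + m) ω - F j ω))| ≤ n * C := by
      refine (Finset.abs_sum_le_sum_abs _ _).trans ?_
      refine (Finset.sum_le_card_nsmul _ _ C fun j _ => ?_).trans (by simp)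
      rw [abs_sub_comm]
      exact hC j m ω
    have h2 : ∑ j ∈ Finset.range n, (F (j + m) ω - F j ω)
        = ∑ j ∈ Finset.range m, (F (n + j) ω - F j ω) := by
      rw [Finset.sum_sub_distrib, Finset.sum_sub_distrib]
      have e1 := Finset.sum_range_add (fun i => F i ω) n m
      have e2 := Finset.sum_range_add (fun i => F i ω) m n
      rw [add_comm m n] at e2
      simp only [add_comm m] at e2
      linarith
    have h3 : |∑ j ∈ Finset.range m, (F (n + j) ω - F j ω - F n ω)| ≤ m * (C + 2 * m * K) := by
      refine (Finset.abs_sum_le_sum_abs _ _).trans ?_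
      refine (Finset.sum_le_card_nsmul _ _ (C + 2 * m * K) fun j hj => ?_).trans
        (by rw [Finset.card_range, nsmul_eq_mul])
      have hjm : (j : ℝ) * K ≤ m * K :=
        mul_le_mul_of_nonneg_right (by exact_mod_cast (Finset.mem_range.1 hj).le) hK0
      have a1 := abs_le.1 (hC n j ω)
      have a2 := abs_le.1 (hK j ω)
      have a3 := abs_le.1 (hK j (Θ^[n] ω))
      rw [abs_le]
      constructor <;> linarith [a1.1, a1.2, a2.1, a2.2, a3.1, a3.2]
    rw [Finset.sum_sub_distrib, h2] at h1
    rw [Finset.sum_sub_distrib] at h3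
    simp only [Finset.sum_const, Finset.card_range, nsmul_eq_mul] at h3
    have a1 := abs_le.1 h1
    have a3 := abs_le.1 h3
    rw [abs_le]
    constructor <;> linarith [a1.1, a1.2, a3.1, a3.2]
  have main : ∀ᵐ ω ∂P, ∀ m : ℕ, ∀ᶠ n : ℕ in atTop,
      |F n ω / n - (∫ ω, F (m + 1) ω ∂P) / (m + 1 : ℕ)| ≤ (C + 2) / (m + 1 : ℕ) := by
    rw [ae_all_iff]
    intro m
    filter_upwards [birkhoff_two P Θ hΘ (F (m + 1)) (hF _) _ (hK _) 1 one_pos] with ω hω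
    obtain ⟨N, hN⟩ := exists_nat_ge ((m + 1 : ℕ) * (C + 2 * (m + 1 : ℕ) * K))
    filter_upwards [hω, eventually_ge_atTop N, eventually_ge_atTop 1] with n h1 h2 h3
    have h4 := key (m + 1) n ω
    have hn : (0 : ℝ) < n := by exact_mod_cast h3
    have hm : (0 : ℝ) < (m + 1 : ℕ) := by positivity
    have h5 : (N : ℝ) ≤ n := by exact_mod_cast h2
    have h6 : |(m + 1 : ℕ) * F n ω - n * ∫ ω, F (m + 1) ω ∂P| ≤ n * (C + 2) := by
      have a1 := abs_le.1 h1
      have a3 := abs_le.1 h4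
      rw [abs_le]
      constructor <;> linarith [a1.1, a1.2, a3.1, a3.2]
    have h7 : F n ω / n - (∫ ω, F (m + 1) ω ∂P) / (m + 1 : ℕ)
        = ((m + 1 : ℕ) * F n ω - n * ∫ ω, F (m + 1) ω ∂P) / (n * (m + 1 : ℕ)) := by
      field_simp
    rw [h7, abs_div, abs_of_pos (mul_pos hn hm), div_le_div_iff₀ (mul_pos hn hm) hm]
    calc _ ≤ n * (C + 2) * (m + 1 : ℕ) := mul_le_mul_of_nonneg_right h6 hm.le
      _ = _ := by ring
  have small : ∀ ε : ℝ, 0 < ε → ∃ m : ℕ, (C + 2) / (m + 1 : ℕ) < ε := by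
    intro ε hε
    obtain ⟨m, hm⟩ := exists_nat_gt ((C + 2) / ε)
    refine ⟨m, ?_⟩
    rw [div_lt_iff₀ hε] at hm
    rw [div_lt_iff₀ (by positivity)]
    push_cast
    nlinarith
  obtain ⟨ω₀, h₀⟩ := main.exists
  have hcau : CauchySeq (fun n : ℕ => F n ω₀ / n) := by
    rw [Metric.cauchySeq_iff']
    intro ε hε
    obtain ⟨m, hm⟩ := small (ε / 2) (by positivity)
    obtain ⟨N, hN⟩ := eventually_atTop.1 (h₀ m)
    refine ⟨N, fun n hn => ?_⟩
    have a1 := abs_le.1 (hN n hn)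
    have a2 := abs_le.1 (hN N le_rfl)
    rw [Real.dist_eq, abs_lt]
    constructor <;> linarith [a1.1, a1.2, a2.1, a2.2]
  obtain ⟨L, hL⟩ := cauchySeq_tendsto_of_complete hcau
  refine ⟨L, ?_⟩
  filter_upwards [main] with ω hω
  rw [Metric.tendsto_atTop'] at hL ⊢
  intro ε hε
  obtain ⟨m, hm⟩ := small (ε / 4) (by positivity)
  obtain ⟨N, hN⟩ := hL (ε / 4) (by positivity)
  obtain ⟨N₁, hN₁⟩ := eventually_atTop.1 ((h₀ m).and (hω m))
  refine ⟨max N N₁, fun n hn => ?_⟩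
  have a1 := abs_le.1 (hN₁ n ((le_max_right _ _).trans hn.le)).1
  have a2 := abs_le.1 (hN₁ n ((le_max_right _ _).trans hn.le)).2
  have a3 := hN n ((le_max_left _ _).trans_lt hn)
  rw [Real.dist_eq, abs_lt] at a3
  rw [Real.dist_eq, abs_lt]
  constructor <;> linarith [a1.1, a1.2, a2.1, a2.2, a3.1, a3.2]


lemma shift_iter {S : Type*} (k : ℕ) (x : ℕ → S) (i : ℕ) : shift^[k] x i = x (i + k) := by
  induction k generalizing x with
  | zero => rfl
  | succ k ih =>
    rw [Function.iterate_succ, Function.comp, ih]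
    simp only [shift]
    congr 1

lemma shift_meas {S : Type*} [MeasurableSpace S] (k : ℕ) :
    Measurable (shift^[k] : (ℕ → S) → ℕ → S) := by
  rw [measurable_pi_iff]
  intro i
  simp only [shift_iter]
  exact measurable_pi_apply _

lemma cyl_eq_preimage {S : Type*} {m : ℕ} (a : Fin m → S) :
    cyl a = (fun (x : ℕ → S) (i : Fin m) => x i) ⁻¹' {a} := by
  ext x
  simp [cyl, funext_iff]

lemma restr_meas {S : Type*} [MeasurableSpace S] (m : ℕ) :
    Measurable (fun (x : ℕ → S) (i : Fin m) => x i) := by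
  rw [measurable_pi_iff]
  intro i
  exact measurable_pi_apply _

lemma cyl_meas {S : Type*} [Fintype S] [MeasurableSpace S] [MeasurableSingletonClass S]
    {m : ℕ} (a : Fin m → S) : MeasurableSet (cyl a) := by
  rw [cyl_eq_preimage]
  exact restr_meas m (measurableSet_singleton a)

/-- The collection of all cylinders. -/
def cylSys (S : Type*) : Set (Set (ℕ → S)) := {s | ∃ (m : ℕ) (a : Fin m → S), s = cyl a}

lemma cylSys_pi (S : Type*) : IsPiSystem (cylSys S) := by
  have aux : ∀ (m n : ℕ) (a : Fin m → S) (b : Fin n → S), m ≤ n → (cyl a ∩ cyl b).Nonempty →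
      cyl a ∩ cyl b = cyl b := by
    rintro m n a b hmn ⟨x, hxa, hxb⟩
    refine Set.inter_eq_right.2 fun y hy i => ?_
    rw [← hxa i]
    have h1 := hxb ⟨i, i.2.trans_le hmn⟩
    have h2 := hy ⟨i, i.2.trans_le hmn⟩
    simp only at h1 h2
    rw [h1, h2]
  rintro s ⟨m, a, rfl⟩ t ⟨n, b, rfl⟩ hne
  rcases le_total m n with h | h
  · exact ⟨n, b, aux m n a b h hne⟩
  · refine ⟨m, a, ?_⟩
    rw [Set.inter_comm] at hne ⊢
    exact aux n m b a h hne

lemma cylSys_gen (S : Type*) [Fintype S] [MeasurableSpace S] [MeasurableSingletonClass S] :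
    (MeasurableSpace.pi : MeasurableSpace (ℕ → S)) = MeasurableSpace.generateFrom (cylSys S) := by
  apply le_antisymm
  · refine iSup_le fun i => ?_
    rintro _ ⟨t, -, rfl⟩
    have : (fun x : ℕ → S => x i) ⁻¹' t
        = ⋃ a ∈ {a : Fin (i + 1) → S | a (Fin.last i) ∈ t}, cyl a := by
      ext x
      simp only [Set.mem_preimage, Set.mem_iUnion]
      constructor
      · intro hx
        exact ⟨fun j => x j, by simpa using hx, fun j => rfl⟩
      · rintro ⟨a, ha, hx⟩
        have := hx (Fin.last i)
        simp only [Fin.val_last] at this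
        rw [this]
        exact ha
    change MeasurableSet[MeasurableSpace.generateFrom (cylSys S)] ((fun x : ℕ → S => x i) ⁻¹' t)
    rw [this]
    refine MeasurableSet.biUnion (Set.to_countable _) fun a _ => ?_
    exact MeasurableSpace.measurableSet_generateFrom ⟨_, a, rfl⟩
  · refine MeasurableSpace.generateFrom_le ?_
    rintro _ ⟨m, a, rfl⟩
    exact cyl_meas a

lemma restrict_map {S : Type*} [Fintype S] [MeasurableSpace S] [MeasurableSingletonClass S]
    (σ : Measure (ℕ → S)) [IsProbabilityMeasure σ]
    (hσ : ∀ (m : ℕ) (a : Fin m → S), σ (cyl a) = (Fintype.card S : ℝ≥0∞)⁻¹ ^ m)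
    (m : ℕ) (a : Fin m → S) :
    (σ.restrict (cyl a)).map shift^[m] = (Fintype.card S : ℝ≥0∞)⁻¹ ^ m • σ := by
  refine ext_of_generate_finite (cylSys S) (cylSys_gen S) (cylSys_pi S) ?_ ?_
  · rintro _ ⟨n, b, rfl⟩
    rw [Measure.map_apply (shift_meas m) (cyl_meas b),
      Measure.restrict_apply (shift_meas m (cyl_meas b))]
    have : shift^[m] ⁻¹' (cyl b) ∩ cyl a = cyl (Fin.append a b) := by
      ext x
      simp only [cyl, Set.mem_inter_iff, Set.mem_preimage, Set.mem_ofPred_eq, shift_iter]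
      constructor
      · rintro ⟨h1, h2⟩ i
        refine Fin.addCases (fun i => ?_) (fun i => ?_) i
        · simpa using h2 i
        · simpa [add_comm] using h1 i
      · intro h
        refine ⟨fun i => ?_, fun i => ?_⟩
        · simpa [add_comm] using h (Fin.natAdd m i)
        · simpa using h (Fin.castAdd n i)
    rw [this, hσ, Measure.smul_apply, hσ, smul_eq_mul, pow_add]
  · rw [Measure.map_apply (shift_meas m) MeasurableSet.univ]
    simp [hσ]

lemma integral_indep {S : Type*} [Fintype S] [MeasurableSpace S] [MeasurableSingletonClass S]
    (σ : Measure (ℕ → S)) [IsProbabilityMeasure σ]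
    (hσ : ∀ (m : ℕ) (a : Fin m → S), σ (cyl a) = (Fintype.card S : ℝ≥0∞)⁻¹ ^ m)
    (m : ℕ) (g : (Fin m → S) → ℝ) (h : (ℕ → S) → ℝ) (hm : Measurable h) (B : ℝ)
    (hB : ∀ x, |h x| ≤ B) :
    ∫ x, g (fun i => x i) * h (shift^[m] x) ∂σ = (∫ x, g (fun i => x i) ∂σ) * ∫ x, h x ∂σ := by
  classical
  have gen : ∀ (h : (ℕ → S) → ℝ), Measurable h → (∀ x, |h x| ≤ B) →
      ∫ x, g (fun i => x i) * h (shift^[m] x) ∂σ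
        = (∑ a : Fin m → S, g a * ((Fintype.card S : ℝ≥0∞)⁻¹ ^ m).toReal) * ∫ x, h x ∂σ := by
    intro h hm hB
    have e1 : ∀ x : ℕ → S, g (fun i => x i) * h (shift^[m] x)
        = ∑ a : Fin m → S, (cyl a).indicator (fun x => g a * h (shift^[m] x)) x := by
      intro x
      rw [Finset.sum_eq_single (fun i : Fin m => x i)]
      · rw [Set.indicator_of_mem]
        intro i
        rfl
      · intro a _ ha
        rw [Set.indicator_of_notMem]
        intro hx
        exact ha (funext fun i => (hx i).symm)
      · intro hx
        exact absurd (Finset.mem_univ _) hx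
    have hi : Integrable (fun x => h (shift^[m] x)) σ :=
      Integrable.of_bound (hm.comp (shift_meas m)).aestronglyMeasurable B
        (ae_of_all _ fun x => hB _)
    simp_rw [e1]
    rw [integral_finset_sum _ fun a _ => (hi.const_mul (g a)).indicator (cyl_meas a),
      Finset.sum_mul]
    refine Finset.sum_congr rfl fun a _ => ?_
    rw [integral_indicator (cyl_meas a), integral_const_mul, mul_assoc]
    congr 1
    have := integral_map (μ := σ.restrict (cyl a)) (shift_meas m).aemeasurable
      (f := h) hm.aestronglyMeasurable
    rw [← this, restrict_map σ hσ, integral_smul_measure, smul_eq_mul]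
  have hB' : ∀ x : ℕ → S, |(fun _ => (0:ℝ)) x| ≤ B := fun x => by
    simpa using (abs_nonneg _).trans (hB x)
  rw [gen h hm hB]
  by_cases hB1 : 0 < B
  · have h2 := gen (fun _ => B) measurable_const (fun x => (abs_of_pos hB1).le)
    simp only [integral_mul_const, integral_const, probReal_univ, one_smul] at h2
    rw [mul_right_cancel₀ hB1.ne' h2]
  · have : ∀ x, h x = 0 := fun x =>
      abs_eq_zero.1 (le_antisymm ((hB x).trans (not_lt.1 hB1)) (abs_nonneg _))
    simp [this]

lemma f_meas {S : Type*} [Fintype S] [TopologicalSpace S]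
    [DiscreteTopology S] [MeasurableSpace S] [BorelSpace S]
    (f : (ℕ → S) → ℝ) (v : ℕ → ℝ) (hv : Summable v)
    (hvar : ∀ (n : ℕ) (x y : ℕ → S), (∀ i, i < n → x i = y i) → |f x - f y| ≤ v n) :
    Measurable f := by
  have : Continuous f := by
    rw [continuous_iff_continuousAt]
    intro x
    rw [ContinuousAt, Metric.tendsto_nhds]
    intro ε hε
    obtain ⟨n, hn⟩ := (hv.tendsto_atTop_zero.eventually (gt_mem_nhds hε)).exists
    have hopen : IsOpen (⋂ i ∈ Set.Iio n, (fun y : ℕ → S => y i) ⁻¹' {x i}) :=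
      (Set.finite_Iio n).isOpen_biInter fun i _ =>
        (isOpen_discrete _).preimage (continuous_apply i)
    filter_upwards [hopen.mem_nhds (by simp)] with y hy
    rw [Real.dist_eq]
    refine (hvar n y x fun i hi => ?_).trans_lt hn
    simp only [Set.mem_iInter] at hy
    exact hy i hi
  exact this.measurable

/-- Log partition function for a deterministic weight sequence. -/
def logZ {S : Type*} [MeasurableSpace S] (σ : Measure (ℕ → S)) (f : (ℕ → S) → ℝ) (w : ℕ → ℝ)
    (n : ℕ) (lam : ℝ) : ℝ :=
  Real.log (∫ x, Real.exp (lam * ∑ k ∈ Finset.range n, w k * f (shift^[k] x)) ∂σ)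

lemma wsum_bdd {S : Type*} (f : (ℕ → S) → ℝ) (Mf : ℝ) (hfb : ∀ x, |f x| ≤ Mf) (w : ℕ → ℝ) (MW : ℝ)
    (hw : ∀ k, |w k| ≤ MW) (n : ℕ) (x : ℕ → S) :
    |∑ k ∈ Finset.range n, w k * f (shift^[k] x)| ≤ n * (MW * Mf) := by
  refine (Finset.abs_sum_le_sum_abs _ _).trans ?_
  refine (Finset.sum_le_card_nsmul _ _ (MW * Mf) fun j _ => ?_).trans
    (by rw [Finset.card_range, nsmul_eq_mul])
  rw [abs_mul]
  exact mul_le_mul (hw j) (hfb _) (abs_nonneg _) ((abs_nonneg _).trans (hw j))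

lemma wsum_meas {S : Type*} [MeasurableSpace S] (f : (ℕ → S) → ℝ) (hf : Measurable f)
    (w : ℕ → ℝ) (n : ℕ) :
    Measurable fun x : ℕ → S => ∑ k ∈ Finset.range n, w k * f (shift^[k] x) :=
  Finset.measurable_fun_sum _ fun k _ => (hf.comp (shift_meas k)).const_mul _

lemma exp_int {X : Type*} [MeasurableSpace X] (σ : Measure X) [IsProbabilityMeasure σ]
    (G : X → ℝ) (hG : Measurable G) (B : ℝ) (hB : ∀ x, |G x| ≤ B) :
    Integrable (fun x => Real.exp (G x)) σ :=
  Integrable.of_bound hG.exp.aestronglyMeasurable (Real.exp B) (ae_of_all _ fun x => by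
    rw [Real.norm_eq_abs, Real.abs_exp, Real.exp_le_exp]
    exact (abs_le.1 (hB x)).2)

/-- Comparison of log-integrals. -/
lemma log_int_exp_le {X : Type*} [MeasurableSpace X] (σ : Measure X) [IsProbabilityMeasure σ]
    (G H : X → ℝ) (hG : Measurable G) (hH : Measurable H) (B : ℝ) (hB : ∀ x, |G x| ≤ B)
    (hB' : ∀ x, |H x| ≤ B) (d : ℝ) (hd : ∀ x, |G x - H x| ≤ d) :
    |Real.log (∫ x, Real.exp (G x) ∂σ) - Real.log (∫ x, Real.exp (H x) ∂σ)| ≤ d := by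
  have aux : ∀ (G H : X → ℝ), Measurable G → Measurable H → (∀ x, |G x| ≤ B) →
      (∀ x, |H x| ≤ B) → (∀ x, |G x - H x| ≤ d) →
      Real.log (∫ x, Real.exp (G x) ∂σ) - Real.log (∫ x, Real.exp (H x) ∂σ) ≤ d := by
    intro G H hG hH hB hB' hd
    have iG := exp_int σ G hG B hB
    have iH := exp_int σ H hH B hB'
    have pG := integral_exp_pos iG
    have pH := integral_exp_pos iH
    have : ∫ x, Real.exp (G x) ∂σ ≤ Real.exp d * ∫ x, Real.exp (H x) ∂σ := by
      rw [← integral_const_mul]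
      refine integral_mono iG (iH.const_mul _) fun x => ?_
      simp only
      rw [← Real.exp_add, Real.exp_le_exp]
      linarith [(abs_le.1 (hd x)).2]
    have h2 := Real.log_le_log pG this
    rw [Real.log_mul (Real.exp_pos d).ne' pH.ne', Real.log_exp] at h2
    linarith
  rw [abs_le]
  constructor
  · have := aux H G hH hG hB' hB (fun x => by rw [abs_sub_comm]; exact hd x)
    linarith
  · exact aux G H hG hH hB hB' hd

lemma distortion {S : Type*} (f : (ℕ → S) → ℝ) (v : ℕ → ℝ) (hv : Summable v)
    (hvar : ∀ (n : ℕ) (x y : ℕ → S), (∀ i, i < n → x i = y i) → |f x - f y| ≤ v n)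
    (w : ℕ → ℝ) (MW : ℝ) (hw : ∀ k, |w k| ≤ MW) (m : ℕ) (x y : ℕ → S)
    (hxy : ∀ i, i < m → x i = y i) :
    |∑ k ∈ Finset.range m, w k * f (shift^[k] x) - ∑ k ∈ Finset.range m, w k * f (shift^[k] y)|
      ≤ MW * ∑' n, v n := by
  have hv0 : ∀ n, 0 ≤ v n := fun n => (abs_nonneg _).trans (hvar n x x fun _ _ => rfl)
  have hM : 0 ≤ MW := (abs_nonneg _).trans (hw 0)
  rw [← Finset.sum_sub_distrib]
  refine (Finset.abs_sum_le_sum_abs _ _).trans ?_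
  have h1 : ∀ k ∈ Finset.range m, |w k * f (shift^[k] x) - w k * f (shift^[k] y)|
      ≤ MW * v (m - 1 - k + 1) := by
    intro k hk
    rw [Finset.mem_range] at hk
    rw [← mul_sub, abs_mul]
    refine mul_le_mul (hw k) (hvar _ _ _ fun i hi => ?_) (abs_nonneg _) hM
    rw [shift_iter, shift_iter]
    exact hxy _ (by omega)
  refine (Finset.sum_le_sum h1).trans ?_
  rw [← Finset.mul_sum, Finset.sum_range_reflect (fun k => v (k + 1)) m]
  refine mul_le_mul_of_nonneg_left ?_ hM
  have h2 := hv.sum_le_tsum (Finset.range (m + 1)) (fun i _ => hv0 i)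
  rw [Finset.sum_range_succ'] at h2
  linarith [hv0 0]

lemma logZ_add {S : Type*} [Fintype S] [Nonempty S] [MeasurableSpace S]
    [MeasurableSingletonClass S]
    (σ : Measure (ℕ → S)) [IsProbabilityMeasure σ]
    (hσ : ∀ (m : ℕ) (a : Fin m → S), σ (cyl a) = (Fintype.card S : ℝ≥0∞)⁻¹ ^ m)
    (f : (ℕ → S) → ℝ) (hf : Measurable f) (Mf : ℝ) (hfb : ∀ x, |f x| ≤ Mf)
    (v : ℕ → ℝ) (hv : Summable v)
    (hvar : ∀ (n : ℕ) (x y : ℕ → S), (∀ i, i < n → x i = y i) → |f x - f y| ≤ v n)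
    (w : ℕ → ℝ) (MW : ℝ) (hw : ∀ k, |w k| ≤ MW) (lam : ℝ) (m n : ℕ) :
    |logZ σ f w (m + n) lam - logZ σ f w m lam - logZ σ f (fun k => w (m + k)) n lam|
      ≤ 2 * (|lam| * (MW * ∑' n, v n)) := by
  classical
  set d := |lam| * (MW * ∑' n, v n) with hd
  let s₀ : S := Classical.arbitrary S
  let e : (Fin m → S) → ℕ → S := fun a i => if h : i < m then a ⟨i, h⟩ else s₀
  let G : (ℕ → S) → ℝ := fun x => lam * ∑ k ∈ Finset.range m, w k * f (shift^[k] x)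
  let H : (ℕ → S) → ℝ := fun x => lam * ∑ k ∈ Finset.range n, w (m + k) * f (shift^[k] x)
  let g : (Fin m → S) → ℝ := fun a => G (e a)
  let r : (ℕ → S) → Fin m → S := fun x i => x i
  have hGm : Measurable G := (wsum_meas f hf w m).const_mul _
  have hHm : Measurable H := (wsum_meas f hf (fun k => w (m + k)) n).const_mul _
  have hgm : Measurable fun x => g (r x) := (measurable_of_finite g).comp (restr_meas m)
  have hHs : Measurable fun x => H (shift^[m] x) := hHm.comp (shift_meas m)
  have hGb : ∀ x, |G x| ≤ |lam| * (m * (MW * Mf)) := fun x => by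
    simp only [G]; rw [abs_mul]
    exact mul_le_mul_of_nonneg_left (wsum_bdd f Mf hfb w MW hw m x) (abs_nonneg _)
  have hHb : ∀ x, |H x| ≤ |lam| * (n * (MW * Mf)) := fun x => by
    simp only [H]; rw [abs_mul]
    exact mul_le_mul_of_nonneg_left
      (wsum_bdd f Mf hfb (fun k => w (m + k)) MW (fun k => hw _) n x) (abs_nonneg _)
  set BG := |lam| * (m * (MW * Mf))
  set BH := |lam| * (n * (MW * Mf))
  have hBG : 0 ≤ BG := (abs_nonneg _).trans (hGb fun _ => s₀)
  have hBH : 0 ≤ BH := (abs_nonneg _).trans (hHb fun _ => s₀)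
  have hGg : ∀ x, |G x - g (r x)| ≤ d := by
    intro x
    simp only [g, G, hd]
    rw [← mul_sub, abs_mul]
    refine mul_le_mul_of_nonneg_left ?_ (abs_nonneg _)
    refine distortion f v hv hvar w MW hw m _ _ fun i hi => ?_
    simp [e, r, hi]
  have hZ : logZ σ f w (m + n) lam = Real.log (∫ x, Real.exp (G x + H (shift^[m] x)) ∂σ) := by
    unfold logZ
    congr 2
    ext x
    simp only [G, H]
    rw [Finset.sum_range_add, mul_add]
    simp only [← Function.iterate_add_apply, add_comm]
  have c1 := log_int_exp_le σ (fun x => G x + H (shift^[m] x)) (fun x => g (r x) + H (shift^[m] x))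
    (hGm.add hHs) (hgm.add hHs) (BG + BH)
    (fun x => (abs_add_le _ _).trans (add_le_add (hGb _) (hHb _)))
    (fun x => (abs_add_le _ _).trans (add_le_add (hGb _) (hHb _))) d
    (fun x => by simpa using hGg x)
  have c2 := log_int_exp_le σ G (fun x => g (r x)) hGm hgm BG hGb (fun x => hGb _) d hGg
  have ig := exp_int σ (fun x => g (r x)) hgm BG (fun x => hGb _)
  have iH := exp_int σ H hHm BH hHb
  have c3 : Real.log (∫ x, Real.exp (g (r x) + H (shift^[m] x)) ∂σ)
      = Real.log (∫ x, Real.exp (g (r x)) ∂σ) + Real.log (∫ x, Real.exp (H x) ∂σ) := by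
    rw [← Real.log_mul (integral_exp_pos ig).ne' (integral_exp_pos iH).ne']
    congr 1
    simp only [Real.exp_add]
    exact integral_indep σ hσ m (fun a => Real.exp (g a)) (fun x => Real.exp (H x)) hHm.exp
      (Real.exp BH) (fun x => by
        rw [Real.abs_exp, Real.exp_le_exp]
        exact (abs_le.1 (hHb x)).2)
  rw [hZ]
  change |_ - Real.log (∫ x, Real.exp (G x) ∂σ) - Real.log (∫ x, Real.exp (H x) ∂σ)| ≤ _
  rw [c3] at c1
  have a1 := abs_le.1 c1
  have a2 := abs_le.1 c2
  rw [abs_le]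
  constructor <;> linarith [a1.1, a1.2, a2.1, a2.2]

lemma logZ_lip {S : Type*} [MeasurableSpace S]
    (σ : Measure (ℕ → S)) [IsProbabilityMeasure σ]
    (f : (ℕ → S) → ℝ) (hf : Measurable f) (Mf : ℝ) (hfb : ∀ x, |f x| ≤ Mf)
    (w : ℕ → ℝ) (MW : ℝ) (hw : ∀ k, |w k| ≤ MW) (n : ℕ) (a b : ℝ) :
    |logZ σ f w n a - logZ σ f w n b| ≤ |a - b| * (n * (MW * Mf)) := by
  have hs := wsum_bdd f Mf hfb w MW hw n
  have hb : ∀ (c : ℝ) (x), |c * ∑ k ∈ Finset.range n, w k * f (shift^[k] x)|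
      ≤ |c| * (n * (MW * Mf)) := fun c x => by
    rw [abs_mul]
    exact mul_le_mul_of_nonneg_left (hs x) (abs_nonneg _)
  refine log_int_exp_le σ _ _ ((wsum_meas f hf w n).const_mul _)
    ((wsum_meas f hf w n).const_mul _)
    (max (|a| * (n * (MW * Mf))) (|b| * (n * (MW * Mf))))
    (fun x => (hb a x).trans (le_max_left _ _)) (fun x => (hb b x).trans (le_max_right _ _)) _
    (fun x => ?_)
  rw [← sub_mul]
  exact hb _ x

lemma logZ_zero {S : Type*} [MeasurableSpace S]
    (σ : Measure (ℕ → S)) [IsProbabilityMeasure σ]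
    (f : (ℕ → S) → ℝ) (w : ℕ → ℝ) (n : ℕ) : logZ σ f w n 0 = 0 := by
  simp [logZ]

lemma logZ_convex {S : Type*} [MeasurableSpace S]
    (σ : Measure (ℕ → S)) [IsProbabilityMeasure σ]
    (f : (ℕ → S) → ℝ) (hf : Measurable f) (Mf : ℝ) (hfb : ∀ x, |f x| ≤ Mf)
    (w : ℕ → ℝ) (MW : ℝ) (hw : ∀ k, |w k| ≤ MW) (n : ℕ) (x y a b : ℝ) (ha : 0 ≤ a) (hb : 0 ≤ b)
    (hab : a + b = 1) :
    logZ σ f w n (a * x + b * y) ≤ a * logZ σ f w n x + b * logZ σ f w n y := by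
  have hs := wsum_bdd f Mf hfb w MW hw n
  have hm := wsum_meas f hf w n
  unfold logZ
  set R : (ℕ → S) → ℝ := fun x => ∑ k ∈ Finset.range n, w k * f (shift^[k] x)
  have hi : ∀ c : ℝ, Integrable (fun z => Real.exp (c * R z)) σ := fun c =>
    exp_int σ _ (hm.const_mul _) (|c| * (n * (MW * Mf))) fun x => by
      rw [abs_mul]
      exact mul_le_mul_of_nonneg_left (hs x) (abs_nonneg _)
  have hp := fun c => integral_exp_pos (hi c)
  change Real.log (∫ z, Real.exp ((a * x + b * y) * R z) ∂σ)
    ≤ a * Real.log (∫ z, Real.exp (x * R z) ∂σ) + b * Real.log (∫ z, Real.exp (y * R z) ∂σ)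
  set A := Real.log (∫ z, Real.exp (x * R z) ∂σ) with hA
  set B := Real.log (∫ z, Real.exp (y * R z) ∂σ) with hB
  rw [Real.log_le_iff_le_exp (hp _)]
  have eA : Real.exp (-A) * ∫ z, Real.exp (x * R z) ∂σ = 1 := by
    rw [Real.exp_neg, hA, Real.exp_log (hp x), inv_mul_cancel₀ (hp x).ne']
  have eB : Real.exp (-B) * ∫ z, Real.exp (y * R z) ∂σ = 1 := by
    rw [Real.exp_neg, hB, Real.exp_log (hp y), inv_mul_cancel₀ (hp y).ne']
  have hle : ∫ z, Real.exp ((a * x + b * y) * R z) ∂σ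
      ≤ ∫ z, (Real.exp (a * A + b * B)) * (a * (Real.exp (-A) * Real.exp (x * R z))
        + b * (Real.exp (-B) * Real.exp (y * R z))) ∂σ := by
    refine integral_mono (hi _) ((((hi x).const_mul _).const_mul _).add
      (((hi y).const_mul _).const_mul _) |>.const_mul _) fun z => ?_
    have := convexOn_exp.2 (Set.mem_univ (x * R z - A)) (Set.mem_univ (y * R z - B)) ha hb hab
    simp only [smul_eq_mul] at this
    simp only [← Real.exp_add]
    have e1 : (a * x + b * y) * R z
      = (a * A + b * B) + (a * (x * R z - A) + b * (y * R z - B)) := by ring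
    rw [e1, Real.exp_add]
    refine mul_le_mul_of_nonneg_left ?_ (Real.exp_pos _).le
    rw [neg_add_eq_sub, neg_add_eq_sub]
    exact this
  refine hle.trans (le_of_eq ?_)
  rw [integral_const_mul, integral_add (((hi x).const_mul _).const_mul _)
    (((hi y).const_mul _).const_mul _)]
  simp only [integral_const_mul]
  rw [eA, eB, mul_one, mul_one, hab, mul_one]

/-- Stationary ergodic weights: for an ergodic measure-preserving map
`Θ` of a probability space, a bounded measurable weight `W` and a function `f` of
bounded variation, there is a (deterministic) convex pressure function `φ̃` such that
almost surely, for every `λ`, `(1/n) log Z_n(λ,ω) → φ̃(λ)`. -/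
theorem stationary_ergodic_pressure {S Ω : Type*} [Fintype S] [TopologicalSpace S]
    [DiscreteTopology S] [MeasurableSpace S] [BorelSpace S] (hq : 2 ≤ Fintype.card S)
    (σ : Measure (ℕ → S)) [IsProbabilityMeasure σ]
    (hσ : ∀ (m : ℕ) (a : Fin m → S), σ (cyl a) = (Fintype.card S : ℝ≥0∞)⁻¹ ^ m)
    [MeasurableSpace Ω] (P : Measure Ω) [IsProbabilityMeasure P]
    (Θ : Ω → Ω) (hΘ : Ergodic Θ P)
    (W : Ω → ℝ) (hWm : Measurable W) (MW : ℝ) (hWb : ∀ ω, |W ω| ≤ MW)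
    (f : (ℕ → S) → ℝ) (Mf : ℝ) (hfb : ∀ x, |f x| ≤ Mf)
    (v : ℕ → ℝ) (hv : Summable v)
    (hvar : ∀ (n : ℕ) (x y : ℕ → S), (∀ i, i < n → x i = y i) → |f x - f y| ≤ v n) :
    ∃ φt : ℝ → ℝ, ConvexOn ℝ Set.univ φt ∧
      ∀ᵐ ω ∂P, ∀ lam : ℝ,
        Tendsto (fun n : ℕ =>
            Real.log (∫ x, Real.exp
              (lam * ∑ k ∈ Finset.range n, W (Θ^[k] ω) * f (shift^[k] x)) ∂σ) / n)
          atTop (𝓝 (φt lam)) := by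
  haveI : Nonempty S := Fintype.card_pos_iff.1 (by omega)
  have hf := f_meas f v hv hvar
  have hΘm := hΘ.measurable
  let w : Ω → ℕ → ℝ := fun ω k => W (Θ^[k] ω)
  have hw : ∀ ω k, |w ω k| ≤ MW := fun ω k => hWb _
  let K := MW * Mf
  have hK0 : 0 ≤ K := by
    obtain ⟨ω⟩ : Nonempty Ω := P.nonempty_of_neZero
    obtain ⟨x⟩ : Nonempty (ℕ → S) := inferInstance
    exact mul_nonneg ((abs_nonneg _).trans (hWb ω)) ((abs_nonneg _).trans (hfb x))
  have hlip : ∀ ω n a b, |logZ σ f (w ω) n a - logZ σ f (w ω) n b| ≤ |a - b| * (n * K) :=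
    fun ω n a b => logZ_lip σ f hf Mf hfb (w ω) MW (hw ω) n a b
  have hlip' : ∀ ω (n : ℕ) a b, |logZ σ f (w ω) n a / n - logZ σ f (w ω) n b / n|
      ≤ |a - b| * K := by
    intro ω n a b
    rw [← sub_div, abs_div, Nat.abs_cast]
    refine div_le_of_le_mul₀ (Nat.cast_nonneg _) (by positivity) ((hlip ω n a b).trans (le_of_eq ?_))
    ring
  have hae : ∀ lam : ℝ, ∃ L : ℝ, ∀ᵐ ω ∂P,
      Tendsto (fun n : ℕ => logZ σ f (w ω) n lam / n) atTop (𝓝 L) := by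
    intro lam
    refine almost_additive P Θ hΘ (fun n ω => logZ σ f (w ω) n lam) ?_ (|lam| * K)
      (2 * (|lam| * (MW * ∑' n, v n))) ?_ ?_
    · intro n
      refine Real.measurable_log.comp ?_
      have : Measurable (Function.uncurry fun (ω : Ω) (x : ℕ → S) =>
          Real.exp (lam * ∑ k ∈ Finset.range n, w ω k * f (shift^[k] x))) := by
        refine (Measurable.const_mul ?_ _).exp
        refine Finset.measurable_fun_sum _ fun k _ => ?_
        exact ((hWm.comp (hΘm.iterate k)).comp measurable_fst).mul
          ((hf.comp (shift_meas k)).comp measurable_snd)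
      exact (this.stronglyMeasurable.integral_prod_right (ν := σ)).measurable
    · intro n ω
      have := hlip ω n lam 0
      rw [logZ_zero, sub_zero, sub_zero] at this
      refine this.trans (le_of_eq ?_)
      ring
    · intro m n ω
      have := logZ_add σ hσ f hf Mf hfb v hv hvar (w ω) MW (hw ω) lam m n
      have e : (fun k => w ω (m + k)) = w (Θ^[m] ω) := by
        funext k
        simp only [w]
        rw [← Function.iterate_add_apply, add_comm]
      rw [e] at this
      exact this
  choose L hL using hae
  have hsq : ∀ᵐ ω ∂P, ∀ q : ℚ,
      Tendsto (fun n : ℕ => logZ σ f (w ω) n q / n) atTop (𝓝 (L q)) :=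
    ae_all_iff.2 fun q => hL q
  have hLlip : ∀ a b, |L a - L b| ≤ |a - b| * K := by
    intro a b
    obtain ⟨ω, h1, h2⟩ := ((hL a).and (hL b)).exists
    exact le_of_tendsto' (h1.sub h2).abs fun n => hlip' ω n a b
  refine ⟨L, ⟨convex_univ, ?_⟩, ?_⟩
  · intro x _ y _ a b ha hb hab
    simp only [smul_eq_mul]
    obtain ⟨ω, h1, h2, h3⟩ := ((hL x).and ((hL y).and (hL (a * x + b * y)))).exists
    refine le_of_tendsto_of_tendsto' h3 ((h1.const_mul a).add (h2.const_mul b)) fun n => ?_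
    have := logZ_convex σ f hf Mf hfb (w ω) MW (hw ω) n x y a b ha hb hab
    calc _ ≤ (a * logZ σ f (w ω) n x + b * logZ σ f (w ω) n y) / n :=
          div_le_div_of_nonneg_right this (Nat.cast_nonneg n)
      _ = _ := by ring
  · filter_upwards [hsq] with ω hω
    intro lam
    change Tendsto (fun n : ℕ => logZ σ f (w ω) n lam / n) atTop (𝓝 (L lam))
    rw [Metric.tendsto_nhds]
    intro ε hε
    obtain ⟨q, hq1, hq2⟩ := exists_rat_btwn
      (show lam < lam + ε / (4 * (K + 1)) from lt_add_of_pos_right _ (by positivity))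
    have hqK : |lam - q| * K ≤ ε / 4 := by
      have h1 : |lam - q| ≤ ε / (4 * (K + 1)) := by
        rw [abs_le]; constructor <;> linarith
      calc |lam - q| * K ≤ ε / (4 * (K + 1)) * (K + 1) := by
            apply mul_le_mul h1 (by linarith) hK0 (by positivity)
        _ = ε / 4 := by field_simp
    filter_upwards [(Metric.tendsto_nhds.1 (hω q)) (ε / 4) (by positivity)] with n hn
    have a1 := abs_le.1 ((hlip' ω n lam q).trans hqK)
    have a2 := abs_le.1 ((hLlip lam q).trans hqK)
    rw [Real.dist_eq, abs_lt] at hn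
    rw [Real.dist_eq, abs_lt]
    constructor <;> linarith [a1.1, a1.2, a2.1, a2.2, hn.1, hn.2]
end
end

section
/- (Stationary ergodic weights, finite-range potential: analyticity of the pressure.) Let (Ω, ℱ, P) be a probability space, Θ: Ω → Ω a measure-preserving ergodic transformation, and W: Ω → ℝ a bounded measurable function. Let r ≥ 1 and let f: X → ℝ be continuous and depend only on the coordinates x_0,…,x_{r−1} (i.e. f(x) = f(y) whenever x_i = y_i for 0 ≤ i < r). Then the function φ̃: ℝ → ℝ defined by φ̃(λ) = lim_{n→∞} (1/n) ∫_Ω log(∫_X exp(λ Σ_{k=0}^{n−1} W(Θ^k ω) f(T^k x)) dσ(x)) dP(ω) is well defined and is real-analytic on ℝ. -/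
open MeasureTheory Filter Finset
open scoped ENNReal Topology

noncomputable section

/-! ### Abstract positive kernels on a finite state space -/

/-- Complex recursion. -/
def gC {E : Type*} [Fintype E] (b : ℕ → E → E → ℝ) (z : ℂ) : ℕ → E → ℂ
  | 0 => fun _ => 1
  | j + 1 => fun v => (Fintype.card E : ℂ)⁻¹ * ∑ u, Complex.exp (z * b j u v) * gC b z j u

/-- Real recursion. -/
def hR {E : Type*} [Fintype E] (b : ℕ → E → E → ℝ) (t : ℝ) : ℕ → E → ℝ
  | 0 => fun _ => 1
  | j + 1 => fun v => (Fintype.card E : ℝ)⁻¹ * ∑ u, Real.exp (t * b j u v) * hR b t j u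

lemma gC_ofReal {E : Type*} [Fintype E] (b : ℕ → E → E → ℝ) (t : ℝ) (j : ℕ) (v : E) :
    gC b (t : ℂ) j v = (hR b t j v : ℂ) := by
  induction j generalizing v with
  | zero => simp [gC, hR]
  | succ j ih => simp [gC, hR, ih]

lemma hR_pos {E : Type*} [Fintype E] [Nonempty E] (b : ℕ → E → E → ℝ) (t : ℝ) (j : ℕ) (v : E) :
    0 < hR b t j v := by
  induction j generalizing v with
  | zero => simp [hR]
  | succ j ih =>
    simp only [hR]
    refine mul_pos (by positivity) (Finset.sum_pos (fun u _ => ?_) Finset.univ_nonempty)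
    exact mul_pos (Real.exp_pos _) (ih u)

lemma exp_bounds {t x B : ℝ} (hx : |x| ≤ B) :
    Real.exp (t * x) ≤ Real.exp (|t| * B) ∧ (Real.exp (|t| * B))⁻¹ ≤ Real.exp (t * x) := by
  have h : |t * x| ≤ |t| * B := by
    rw [abs_mul]; exact mul_le_mul_of_nonneg_left hx (abs_nonneg _)
  rw [abs_le] at h
  rw [← Real.exp_neg]
  exact ⟨Real.exp_le_exp.2 h.2, Real.exp_le_exp.2 h.1⟩

lemma hR_comparable {E : Type*} [Fintype E] [Nonempty E] (b : ℕ → E → E → ℝ) (t B : ℝ)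
    (hB : 0 ≤ B) (hb : ∀ j u v, |b j u v| ≤ B) (j : ℕ) (v w : E) :
    hR b t j v ≤ Real.exp (|t| * B) ^ 2 * hR b t j w := by
  have ha : 1 ≤ Real.exp (|t| * B) := Real.one_le_exp (by positivity)
  cases j with
  | zero => simp only [hR]; nlinarith
  | succ j =>
    simp only [hR]
    rw [mul_left_comm]
    refine mul_le_mul_of_nonneg_left ?_ (by positivity)
    rw [Finset.mul_sum]
    refine Finset.sum_le_sum fun u _ => ?_
    rw [← mul_assoc]
    refine mul_le_mul_of_nonneg_right ?_ (hR_pos b t j u).le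
    have h1 := (exp_bounds (t := t) (hb j u v)).1
    have h2 := (exp_bounds (t := t) (hb j u w)).2
    rw [inv_le_iff_one_le_mul₀ (Real.exp_pos _)] at h2
    calc _ ≤ Real.exp (|t| * B) := h1
      _ ≤ Real.exp (|t| * B) * (Real.exp (t * b j u w) * Real.exp (|t| * B)) := by
        nlinarith
      _ = _ := by ring

lemma hR_step_bounds {E : Type*} [Fintype E] [Nonempty E] (b : ℕ → E → E → ℝ) (t B : ℝ)
    (hB : 0 ≤ B) (hb : ∀ j u v, |b j u v| ≤ B) (j : ℕ) (u v : E) :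
    hR b t (j + 1) v ≤ Real.exp (|t| * B) ^ 3 * hR b t j u := by
  have hN : (0 : ℝ) < Fintype.card E := by exact_mod_cast Fintype.card_pos
  simp only [hR]
  rw [inv_mul_le_iff₀ hN]
  calc _ ≤ ∑ _u' : E, Real.exp (|t| * B) * (Real.exp (|t| * B) ^ 2 * hR b t j u) := by
        refine Finset.sum_le_sum fun u' _ => ?_
        refine mul_le_mul (exp_bounds (hb j u' v)).1 (hR_comparable b t B hB hb j u' u)
          (hR_pos _ _ _ _).le (Real.exp_pos _).le
    _ = _ := by
        rw [Finset.sum_const, Finset.card_univ, nsmul_eq_mul]; ring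

/-- Independent-coupling contraction. -/
lemma doeblin {E : Type*} [Fintype E] (p p' : E → ℝ) (k : E → ℂ) (δ D : ℝ)
    (hp : ∀ u, δ ≤ p u) (hp' : ∀ u, 0 ≤ p' u) (hp0 : ∀ u, 0 ≤ p u)
    (h1 : ∑ u, p u = 1) (h1' : ∑ u, p' u = 1) (hD : ∀ u v, ‖k u - k v‖ ≤ D) (hD0 : 0 ≤ D) :
    ‖∑ u, (p u : ℂ) * k u - ∑ u, (p' u : ℂ) * k u‖ ≤ (1 - δ) * D := by
  classical
  have h1c : ∑ u, (p u : ℂ) = 1 := by exact_mod_cast h1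
  have h1c' : ∑ u, (p' u : ℂ) = 1 := by exact_mod_cast h1'
  have key : ∑ u, (p u : ℂ) * k u - ∑ u, (p' u : ℂ) * k u
      = ∑ u, ∑ w, (p u : ℂ) * (p' w : ℂ) * (k u - k w) := by
    have e1 : ∑ u, ∑ w, (p u : ℂ) * (p' w : ℂ) * k u = ∑ u, (p u : ℂ) * k u := by
      refine Finset.sum_congr rfl fun u _ => ?_
      rw [← Finset.sum_mul, ← Finset.mul_sum, h1c', mul_one]
    have e2 : ∑ u, ∑ w, (p u : ℂ) * (p' w : ℂ) * k w = ∑ u, (p' u : ℂ) * k u := by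
      rw [Finset.sum_comm]
      refine Finset.sum_congr rfl fun u _ => ?_
      rw [← Finset.sum_mul, ← Finset.sum_mul, h1c, one_mul]
    simp only [mul_sub, Finset.sum_sub_distrib, e1, e2]
  rw [key]
  calc _ ≤ ∑ u, ∑ w, ‖(p u : ℂ) * (p' w : ℂ) * (k u - k w)‖ :=
        (norm_sum_le _ _).trans (Finset.sum_le_sum fun u _ => norm_sum_le _ _)
    _ ≤ ∑ u, ∑ w, (p u * p' w * D - if u = w then p u * p' w * D else 0) := by
        refine Finset.sum_le_sum fun u _ => Finset.sum_le_sum fun w _ => ?_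
        by_cases h : u = w
        · simp [h]
        · simp only [h, if_false, sub_zero, norm_mul, Complex.norm_real, Real.norm_eq_abs,
            abs_of_nonneg (hp0 u), abs_of_nonneg (hp' w)]
          exact mul_le_mul_of_nonneg_left (hD u w) (mul_nonneg (hp0 u) (hp' w))
    _ = D - ∑ u, p u * p' u * D := by
        simp only [Finset.sum_sub_distrib, Finset.sum_ite_eq, Finset.mem_univ, if_true]
        congr 1
        simp only [← Finset.sum_mul, ← Finset.mul_sum, h1', mul_one, h1, one_mul]
    _ ≤ D - ∑ u, δ * p' u * D := by
        refine sub_le_sub_left (Finset.sum_le_sum fun u _ => ?_) _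
        exact mul_le_mul_of_nonneg_right (mul_le_mul_of_nonneg_right (hp u) (hp' u)) hD0
    _ = _ := by
        rw [← Finset.sum_mul, ← Finset.mul_sum, h1']; ring

/-- One step of the perturbed Markov recursion preserves the cone. -/
lemma cone_step {E : Type*} [Fintype E] (s : E) (p : E → E → ℝ) (e : E → E → ℂ) (k : E → ℂ)
    (δ : ℝ) (hδ : 0 < δ) (hδ1 : δ ≤ 1)
    (hp : ∀ v u, δ ≤ p v u) (h1 : ∀ v, ∑ u, p v u = 1)
    (he : ∀ v u, ‖e v u - 1‖ ≤ δ ^ 2 / 16)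
    (hk : ∀ u v, ‖k u - k v‖ ≤ δ / 4 * ‖k s‖) (hs : k s ≠ 0)
    (k' : E → ℂ) (hk' : ∀ v, k' v = ∑ u, (p v u : ℂ) * e v u * k u) :
    (∀ u v, ‖k' u - k' v‖ ≤ δ / 4 * ‖k' s‖) ∧ k' s ≠ 0 ∧ ‖k' s / k s - 1‖ ≤ 1 / 2 := by
  have hp0 : ∀ v u, 0 ≤ p v u := fun v u => hδ.le.trans (hp v u)
  have ks : 0 < ‖k s‖ := norm_pos_iff.2 hs
  have hku : ∀ u, ‖k u‖ ≤ (1 + δ / 4) * ‖k s‖ := fun u => by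
    have := norm_add_le (k u - k s) (k s)
    rw [sub_add_cancel] at this
    linarith [hk u s]
  have havg : ∀ v, ‖k' v - ∑ u, (p v u : ℂ) * k u‖ ≤ δ ^ 2 / 16 * ((1 + δ / 4) * ‖k s‖) := by
    intro v
    rw [hk', ← Finset.sum_sub_distrib]
    calc _ ≤ ∑ u, ‖(p v u : ℂ) * e v u * k u - (p v u : ℂ) * k u‖ := norm_sum_le _ _
      _ ≤ ∑ u, p v u * (δ ^ 2 / 16 * ((1 + δ / 4) * ‖k s‖)) := by
        refine Finset.sum_le_sum fun u _ => ?_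
        have : (p v u : ℂ) * e v u * k u - (p v u : ℂ) * k u = p v u * ((e v u - 1) * k u) := by
          ring
        rw [this, norm_mul, norm_mul, Complex.norm_real, Real.norm_eq_abs,
          abs_of_nonneg (hp0 v u)]
        refine mul_le_mul_of_nonneg_left ?_ (hp0 v u)
        exact mul_le_mul (he v u) (hku u) (norm_nonneg _) (by positivity)
      _ = _ := by rw [← Finset.sum_mul, h1, one_mul]
  have hdist : ‖k' s - k s‖ ≤ (δ / 4 + δ ^ 2 / 16 * (1 + δ / 4)) * ‖k s‖ := by
    have h2 : ‖∑ u, (p s u : ℂ) * k u - k s‖ ≤ δ / 4 * ‖k s‖ := by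
      have h1c : ∑ u, (p s u : ℂ) = 1 := by exact_mod_cast h1 s
      have : ∑ u, (p s u : ℂ) * k u - k s = ∑ u, (p s u : ℂ) * (k u - k s) := by
        simp only [mul_sub, Finset.sum_sub_distrib, ← Finset.sum_mul, h1c, one_mul]
      rw [this]
      calc _ ≤ ∑ u, ‖(p s u : ℂ) * (k u - k s)‖ := norm_sum_le _ _
        _ ≤ ∑ u, p s u * (δ / 4 * ‖k s‖) := by
          refine Finset.sum_le_sum fun u _ => ?_
          rw [norm_mul, Complex.norm_real, Real.norm_eq_abs, abs_of_nonneg (hp0 s u)]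
          exact mul_le_mul_of_nonneg_left (hk u s) (hp0 s u)
        _ = _ := by rw [← Finset.sum_mul, h1, one_mul]
    have h3 := norm_add_le (k' s - ∑ u, (p s u : ℂ) * k u) (∑ u, (p s u : ℂ) * k u - k s)
    rw [sub_add_sub_cancel] at h3
    linarith [havg s]
  have hlow : (1 - (δ / 4 + δ ^ 2 / 16 * (1 + δ / 4))) * ‖k s‖ ≤ ‖k' s‖ := by
    have h4 := norm_sub_norm_le (k s) (k' s)
    rw [norm_sub_rev] at h4
    linarith
  have hδ2 : δ ^ 2 ≤ δ := by nlinarith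
  have hδ3 : δ ^ 3 ≤ δ ^ 2 := by nlinarith [sq_nonneg δ]
  have hsmall : δ / 4 + δ ^ 2 / 16 * (1 + δ / 4) ≤ 1 / 2 := by nlinarith
  refine ⟨fun u v => ?_, ?_, ?_⟩
  · have hd := doeblin (p u) (p v) k δ (δ / 4 * ‖k s‖) (hp u) (hp0 v) (hp0 u) (h1 u) (h1 v) hk
      (by positivity)
    have e1 : k' u - k' v = (k' u - ∑ w, (p u w : ℂ) * k w)
        + (∑ w, (p u w : ℂ) * k w - ∑ w, (p v w : ℂ) * k w)
        - (k' v - ∑ w, (p v w : ℂ) * k w) := by ring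
    have h5 : ‖k' u - k' v‖ ≤ δ ^ 2 / 16 * ((1 + δ / 4) * ‖k s‖) + (1 - δ) * (δ / 4 * ‖k s‖)
        + δ ^ 2 / 16 * ((1 + δ / 4) * ‖k s‖) := by
      rw [e1]
      exact (norm_sub_le _ _).trans (add_le_add ((norm_add_le _ _).trans
        (add_le_add (havg u) hd)) (havg v))
    have h6 : δ / 4 * ((1 - (δ / 4 + δ ^ 2 / 16 * (1 + δ / 4))) * ‖k s‖) ≤ δ / 4 * ‖k' s‖ :=
      mul_le_mul_of_nonneg_left hlow (by positivity)
    have h7 : δ ^ 2 / 16 * (1 + δ / 4) + (1 - δ) * (δ / 4) + δ ^ 2 / 16 * (1 + δ / 4)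
        ≤ δ / 4 * (1 - (δ / 4 + δ ^ 2 / 16 * (1 + δ / 4))) := by
      have hδ4 : δ ^ 4 ≤ δ ^ 3 := by nlinarith [pow_pos hδ 3]
      nlinarith
    have h8 := mul_le_mul_of_nonneg_right h7 ks.le
    linarith
  · rw [← norm_pos_iff]
    nlinarith
  · have : k' s / k s - 1 = (k' s - k s) / k s := by field_simp
    rw [this, norm_div, div_le_iff₀ ks]
    exact hdist.trans (mul_le_mul_of_nonneg_right hsmall ks.le)

/-- Normalised one-step ratio. -/
def ratio {E : Type*} [Fintype E] (s : E) (b : ℕ → E → E → ℝ) (t0 : ℝ) (j : ℕ) (z : ℂ) : ℂ :=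
  (gC b z (j + 1) s / (hR b t0 (j + 1) s : ℂ)) / (gC b z j s / (hR b t0 j s : ℂ))

lemma ratio_bound {E : Type*} [Fintype E] (s : E) (t0 B : ℝ) (hB : 0 ≤ B) :
    ∃ ε : ℝ, 0 < ε ∧ ∀ b : ℕ → E → E → ℝ, (∀ j u v, |b j u v| ≤ B) → ∀ z : ℂ, ‖z - t0‖ < ε →
      ∀ j, gC b z j s ≠ 0 ∧ ‖ratio s b t0 j z - 1‖ ≤ 1 / 2 := by
  have : Nonempty E := ⟨s⟩
  have hN : (0 : ℝ) < Fintype.card E := by exact_mod_cast Fintype.card_pos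
  have hN1 : (1 : ℝ) ≤ Fintype.card E := by exact_mod_cast Fintype.card_pos
  set a := Real.exp (|t0| * B) with ha
  have ha1 : 1 ≤ a := Real.one_le_exp (by positivity)
  set δ : ℝ := (Fintype.card E : ℝ)⁻¹ * (a ^ 4)⁻¹ with hδdef
  have hδ : 0 < δ := by positivity
  have hδ1 : δ ≤ 1 := by
    have h1 : (Fintype.card E : ℝ)⁻¹ ≤ 1 := inv_le_one_of_one_le₀ hN1
    have h2 : (a ^ 4)⁻¹ ≤ 1 := inv_le_one_of_one_le₀ (one_le_pow₀ ha1)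
    exact mul_le_one₀ h1 (by positivity) h2
  refine ⟨δ ^ 2 / 32 / (B + 1), by positivity, fun b hb z hz => ?_⟩
  set k : ℕ → E → ℂ := fun j v => gC b z j v / (hR b t0 j v : ℂ) with hk
  have hpos := hR_pos b t0
  have step : ∀ j, (∀ u v, ‖k j u - k j v‖ ≤ δ / 4 * ‖k j s‖) → k j s ≠ 0 →
      (∀ u v, ‖k (j + 1) u - k (j + 1) v‖ ≤ δ / 4 * ‖k (j + 1) s‖) ∧ k (j + 1) s ≠ 0 ∧
        ‖k (j + 1) s / k j s - 1‖ ≤ 1 / 2 := by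
    intro j h1 h2
    refine cone_step s (fun v u => (Fintype.card E : ℝ)⁻¹ * Real.exp (t0 * b j u v) * hR b t0 j u
      / hR b t0 (j + 1) v) (fun v u => Complex.exp ((z - t0) * b j u v)) (k j) δ hδ hδ1
      ?_ ?_ ?_ h1 h2 (k (j + 1)) ?_
    · intro v u
      rw [le_div_iff₀ (hpos _ _)]
      have e1 := hR_step_bounds b t0 B hB hb j u v
      have e2 := (exp_bounds (t := t0) (hb j u v)).2
      rw [← ha] at e1 e2
      calc δ * hR b t0 (j + 1) v ≤ δ * (a ^ 3 * hR b t0 j u) :=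
            mul_le_mul_of_nonneg_left e1 hδ.le
        _ = (Fintype.card E : ℝ)⁻¹ * a⁻¹ * hR b t0 j u := by
            rw [hδdef]; field_simp
        _ ≤ _ := by
            refine mul_le_mul_of_nonneg_right ?_ (hpos _ _).le
            exact mul_le_mul_of_nonneg_left e2 (by positivity)
    · intro v
      rw [← Finset.sum_div, div_eq_one_iff_eq (hpos _ _).ne']
      simp only [hR, Finset.mul_sum, mul_assoc]
    · intro v u
      have hx : ‖(z - t0) * (b j u v : ℂ)‖ ≤ δ ^ 2 / 32 := by
        rw [norm_mul, Complex.norm_real, Real.norm_eq_abs]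
        calc _ ≤ δ ^ 2 / 32 / (B + 1) * (B + 1) :=
              mul_le_mul hz.le (by linarith [hb j u v]) (abs_nonneg _) (by positivity)
          _ = _ := by field_simp
      have := Complex.norm_exp_sub_one_le (x := (z - t0) * (b j u v : ℂ)) (by nlinarith)
      linarith
    · intro v
      have hv : (hR b t0 (j + 1) v : ℂ) ≠ 0 := by exact_mod_cast (hpos (j + 1) v).ne'
      simp only [hk]
      rw [div_eq_iff hv, Finset.sum_mul]
      simp only [gC]
      rw [Finset.mul_sum]
      refine Finset.sum_congr rfl fun u _ => ?_
      have hu : (hR b t0 j u : ℂ) ≠ 0 := by exact_mod_cast (hpos j u).ne'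
      have hexp : Complex.exp (z * b j u v)
          = Complex.exp (t0 * b j u v) * Complex.exp ((z - t0) * b j u v) := by
        rw [← Complex.exp_add]; ring_nf
      rw [hexp]
      push_cast
      field_simp
  have inv : ∀ j, (∀ u v, ‖k j u - k j v‖ ≤ δ / 4 * ‖k j s‖) ∧ k j s ≠ 0 := by
    intro j
    induction j with
    | zero => simp [hk, gC, hR]; positivity
    | succ j ih => exact ⟨(step j ih.1 ih.2).1, (step j ih.1 ih.2).2.1⟩
  intro j
  refine ⟨fun h => (inv j).2 (by simp [hk, h]), (step j (inv j).1 (inv j).2).2.2⟩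

lemma gC_differentiable {E : Type*} [Fintype E] (b : ℕ → E → E → ℝ) (j : ℕ) (v : E) :
    Differentiable ℂ (fun z => gC b z j v) := by
  induction j generalizing v with
  | zero => simp [gC]
  | succ j ih =>
    simp only [gC]
    refine Differentiable.const_mul (Differentiable.fun_sum fun u _ => ?_) _
    exact Differentiable.mul (by fun_prop) (ih u)

lemma gC_measurable {E Ω : Type*} [Fintype E] [MeasurableSpace Ω] (b : Ω → ℕ → E → E → ℝ)
    (hb : ∀ j u v, Measurable fun ω => b ω j u v) (z : ℂ) (j : ℕ) (v : E) :
    Measurable (fun ω => gC (b ω) z j v) := by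
  induction j generalizing v with
  | zero => simp [gC]
  | succ j ih =>
    simp only [gC]
    refine Measurable.const_mul (Finset.measurable_fun_sum _ fun u _ => ?_) _
    have := hb j u v
    have := ih u
    fun_prop

lemma hR_measurable {E Ω : Type*} [Fintype E] [MeasurableSpace Ω] (b : Ω → ℕ → E → E → ℝ)
    (hb : ∀ j u v, Measurable fun ω => b ω j u v) (t : ℝ) (j : ℕ) (v : E) :
    Measurable (fun ω => hR (b ω) t j v) := by
  induction j generalizing v with
  | zero => simp [hR]
  | succ j ih =>
    simp only [hR]
    refine Measurable.const_mul (Finset.measurable_fun_sum _ fun u _ => ?_) _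
    have := hb j u v
    have := ih u
    fun_prop

/-- Submultiplicativity up to a constant. -/
lemma hR_submul {E : Type*} [Fintype E] (b : ℕ → E → E → ℝ) (t : ℝ) (m : ℕ) (K : ℝ)
    (hK : ∀ u, hR b t m u ≤ K) (n : ℕ) (v : E) :
    hR b t (m + n) v ≤ K * hR (fun j => b (m + j)) t n v := by
  induction n generalizing v with
  | zero => simpa [hR] using hK v
  | succ n ih =>
    rw [← add_assoc]
    simp only [hR]
    rw [mul_left_comm]
    refine mul_le_mul_of_nonneg_left ?_ (by positivity)
    rw [Finset.mul_sum]
    refine Finset.sum_le_sum fun u _ => ?_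
    rw [mul_left_comm]
    exact mul_le_mul_of_nonneg_left (ih u) (Real.exp_pos _).le
/-! ### A Vitali type lemma -/

lemma vitali {F : ℕ → ℂ → ℂ} {φ : ℝ → ℝ} {t0 ε C : ℝ} (hε : 0 < ε)
    (hd : ∀ n, DifferentiableOn ℂ (F n) (Metric.ball (t0 : ℂ) ε))
    (hb : ∀ n, ∀ z ∈ Metric.ball (t0 : ℂ) ε, ‖F n z‖ ≤ C)
    (hφ : ∀ t : ℝ, |t - t0| < ε → Tendsto (fun n => (F n t).re) atTop (𝓝 (φ t))) :
    AnalyticAt ℝ φ t0 := by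
  set ρ := ε / 2 with hρ
  have hρ0 : 0 < ρ := by positivity
  have hsub : Metric.closedBall (t0 : ℂ) ρ ⊆ Metric.ball (t0 : ℂ) ε :=
    Metric.closedBall_subset_ball (by linarith)
  set a : ℕ → ℕ → ℂ := fun n k => (k.factorial : ℂ)⁻¹ * iteratedDeriv k (F n) t0 with ha
  have hbound : ∀ n k, ‖a n k‖ ≤ C / ρ ^ k := by
    intro n k
    have := Complex.norm_iteratedDeriv_le_of_forall_mem_sphere_norm_le (c := (t0 : ℂ)) (f := F n)
      (C := C) k hρ0
      (((hd n).mono (closure_minimal (Metric.ball_subset_closedBall.trans le_rfl)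
        Metric.isClosed_closedBall |>.trans hsub)).diffContOnCl)
      (fun z hz => hb n z (hsub (Metric.sphere_subset_closedBall hz)))
    simp only [ha, norm_mul, norm_inv, Complex.norm_natCast]
    have hk : (0 : ℝ) < k.factorial := by exact_mod_cast k.factorial_pos
    rw [inv_mul_le_iff₀ hk]
    refine this.trans (le_of_eq ?_)
    ring
  obtain ⟨A, -, ns, hns, hA⟩ : ∃ A ∈ Set.pi Set.univ
      (fun k : ℕ => Metric.closedBall (0 : ℂ) (C / ρ ^ k)), ∃ ns : ℕ → ℕ, StrictMono ns ∧
      Tendsto (a ∘ ns) atTop (𝓝 A) := by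
    refine (isCompact_univ_pi fun k => isCompact_closedBall (0 : ℂ) (C / ρ ^ k)).isSeqCompact
      (fun n => ?_)
    intro k _
    simpa using hbound n k
  have hAk : ∀ k, Tendsto (fun i => a (ns i) k) atTop (𝓝 (A k)) := fun k =>
    (tendsto_pi_nhds.1 hA) k
  have hAb : ∀ k, ‖A k‖ ≤ C / ρ ^ k := fun k =>
    le_of_tendsto (hAk k).norm (Eventually.of_forall fun i => hbound _ k)
  -- the limit function
  set G : ℂ → ℂ := fun z => ∑' k, A k * (z - t0) ^ k with hG
  have hsumm : ∀ y : ℝ, 0 ≤ y → y < ρ → Summable fun k : ℕ => C / ρ ^ k * y ^ k := by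
    intro y hy hyρ
    have : Summable fun k : ℕ => C * (y / ρ) ^ k :=
      (summable_geometric_of_lt_one (by positivity) ((div_lt_one hρ0).2 hyρ)).mul_left C
    refine this.congr fun k => ?_
    rw [div_pow]; ring
  have hGd : DifferentiableOn ℂ G (Metric.ball (t0 : ℂ) (ρ / 2)) := by
    refine Complex.differentiableOn_tsum_of_summable_norm (hsumm (ρ / 2) (by positivity)
      (by linarith)) (fun k => by fun_prop) Metric.isOpen_ball ?_
    intro k w hw
    rw [norm_mul, norm_pow]
    rw [Metric.mem_ball, dist_eq_norm] at hw
    exact mul_le_mul (hAb k) (pow_le_pow_left₀ (norm_nonneg _) hw.le _) (by positivity)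
      ((norm_nonneg _).trans (hAb k))
  have hGa : AnalyticAt ℂ G (t0 : ℂ) :=
    hGd.analyticAt (Metric.ball_mem_nhds _ (by positivity))
  have heq : ∀ t : ℝ, |t - t0| < ρ → φ t = (G t).re := by
    intro t ht
    have hn : ‖(t : ℂ) - t0‖ = |t - t0| := by
      rw [← Complex.ofReal_sub, Complex.norm_real, Real.norm_eq_abs]
    have h1 : ∀ n, ∑' k, a n k * ((t : ℂ) - t0) ^ k = F n t := by
      intro n
      have := Complex.taylorSeries_eq_on_ball' (c := (t0 : ℂ)) (r := ε) (z := (t : ℂ)) (f := F n)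
        (by rw [Metric.mem_ball, dist_eq_norm, hn]; linarith) (hd n)
      rw [← this]
    have h2 : Tendsto (fun i => F (ns i) t) atTop (𝓝 (G t)) := by
      simp only [← h1]
      refine tendsto_tsum_of_dominated_convergence (hsumm _ (abs_nonneg (t - t0)) ht)
        (fun k => (hAk k).mul_const _) (Eventually.of_forall fun i k => ?_)
      rw [norm_mul, norm_pow, hn]
      exact mul_le_mul_of_nonneg_right (hbound _ k) (by positivity)
    have h3 : Tendsto (fun i => (F (ns i) t).re) atTop (𝓝 (G t).re) :=
      (Complex.continuous_re.tendsto _).comp h2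
    exact tendsto_nhds_unique ((hφ t (by linarith)).comp hns.tendsto_atTop) h3
  have hre : AnalyticAt ℝ (fun t : ℝ => (G (t : ℂ)).re) t0 := hGa.re_ofReal
  refine hre.congr ?_
  filter_upwards [Metric.ball_mem_nhds t0 hρ0] with t ht
  rw [Metric.mem_ball, Real.dist_eq] at ht
  exact (heq t ht).symm

/-- Parametric integrals of bounded holomorphic functions are holomorphic. -/
lemma differentiableOn_integral {Ω : Type*} [MeasurableSpace Ω] (P : Measure Ω)
    [IsProbabilityMeasure P] {L : ℂ → Ω → ℂ} {c : ℂ} {ε C : ℝ}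
    (hm : ∀ z, Measurable (L z))
    (hd : ∀ ω, DifferentiableOn ℂ (fun z => L z ω) (Metric.ball c ε))
    (hb : ∀ ω, ∀ z ∈ Metric.ball c ε, ‖L z ω‖ ≤ C) :
    DifferentiableOn ℂ (fun z => ∫ ω, L z ω ∂P) (Metric.ball c ε) := by
  intro z0 hz0
  obtain ⟨ρ, hρ, hρs⟩ : ∃ ρ > 0, Metric.closedBall z0 (2 * ρ) ⊆ Metric.ball c ε := by
    obtain ⟨ρ, hρ, h⟩ := Metric.isOpen_iff.1 Metric.isOpen_ball z0 hz0
    exact ⟨ρ / 4, by positivity, (Metric.closedBall_subset_ball (by linarith)).trans h⟩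
  have hDA : ∀ ω, ∀ z ∈ Metric.ball c ε, HasDerivAt (fun z => L z ω) (deriv (fun z => L z ω) z) z :=
    fun ω z hz => ((hd ω).differentiableAt (Metric.isOpen_ball.mem_nhds hz)).hasDerivAt
  have hsub : ∀ z ∈ Metric.ball z0 ρ, Metric.closedBall z ρ ⊆ Metric.ball c ε := by
    intro z hz
    refine (Metric.closedBall_subset_closedBall' ?_).trans hρs
    rw [Metric.mem_ball] at hz
    linarith
  have hmeas : Measurable (fun ω => deriv (fun z => L z ω) z0) := by
    have hu : Tendsto (fun n : ℕ => z0 + (((n : ℝ) + 1)⁻¹ : ℝ)) atTop (𝓝[≠] z0) := by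
      rw [tendsto_nhdsWithin_iff]
      constructor
      · have h0 : Tendsto (fun n : ℕ => (((n : ℝ) + 1)⁻¹ : ℝ)) atTop (𝓝 0) := by
          simpa [one_div] using tendsto_one_div_add_atTop_nhds_zero_nat (𝕜 := ℝ)
        have h1 := (Complex.continuous_ofReal.tendsto 0).comp h0
        simpa using h1.const_add z0
      · refine Eventually.of_forall fun n => ?_
        have : ((n : ℝ) + 1)⁻¹ ≠ 0 := by positivity
        simp only [Set.mem_compl_iff, Set.mem_singleton_iff, add_eq_left]
        exact_mod_cast this
    refine measurable_of_tendsto_metrizable (f := fun (n : ℕ) ω =>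
      slope (fun z => L z ω) z0 (z0 + (((n : ℝ) + 1)⁻¹ : ℝ))) (fun n => ?_) ?_
    · simp only [slope_def_module]
      exact ((hm _).sub (hm _)).const_smul (_ : ℂ)
    · rw [tendsto_pi_nhds]
      intro ω
      exact (hasDerivAt_iff_tendsto_slope.1 (hDA ω z0 hz0)).comp hu
  have := hasDerivAt_integral_of_dominated_loc_of_deriv_le (μ := P) (F := L) (x₀ := z0)
    (s := Metric.ball z0 ρ) (bound := fun _ => C / ρ)
    (F' := fun z ω => deriv (fun z => L z ω) z) (Metric.ball_mem_nhds z0 hρ)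
    (Eventually.of_forall fun z => (hm z).aestronglyMeasurable)
    (Integrable.of_bound (hm z0).aestronglyMeasurable C
      (Eventually.of_forall fun ω => hb ω z0 hz0))
    hmeas.aestronglyMeasurable
    (Eventually.of_forall fun ω z hz => ?_) (integrable_const _)
    (Eventually.of_forall fun ω z hz => hDA ω z (hsub z hz (Metric.mem_closedBall_self hρ.le)))
  · exact this.2.differentiableAt.differentiableWithinAt
  · refine Complex.norm_deriv_le_of_forall_mem_sphere_norm_le hρ ?_
      (fun w hw => hb ω w (hsub z hz (Metric.sphere_subset_closedBall hw)))
    exact ((hd ω).mono (closure_minimal Metric.ball_subset_closedBall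
        Metric.isClosed_closedBall |>.trans (hsub z hz))).diffContOnCl
/-! ### The abstract pressure -/

lemma hR_growth {E : Type*} [Fintype E] [Nonempty E] (b : ℕ → E → E → ℝ) (t B : ℝ)
    (hb : ∀ j u v, |b j u v| ≤ B) (m : ℕ) (v : E) :
    hR b t m v ≤ Real.exp (m * (|t| * B)) ∧ Real.exp (-(m * (|t| * B))) ≤ hR b t m v := by
  have hN : (0 : ℝ) < Fintype.card E := by exact_mod_cast Fintype.card_pos
  induction m generalizing v with
  | zero => simp [hR]
  | succ m ih =>
    simp only [hR]
    rw [inv_mul_le_iff₀ hN, le_inv_mul_iff₀ hN]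
    have e1 : ∀ c : ℝ, (Fintype.card E : ℝ) * c = ∑ _u : E, c := fun c => by simp
    rw [e1, e1]
    constructor
    · refine Finset.sum_le_sum fun u _ => ?_
      calc _ ≤ Real.exp (|t| * B) * Real.exp (m * (|t| * B)) :=
            mul_le_mul (exp_bounds (hb m u v)).1 (ih u).1 (hR_pos _ _ _ _).le (Real.exp_pos _).le
        _ = _ := by rw [← Real.exp_add]; push_cast; ring_nf
    · refine Finset.sum_le_sum fun u _ => ?_
      calc _ = (Real.exp (|t| * B))⁻¹ * Real.exp (-(m * (|t| * B))) := by
            rw [← Real.exp_neg, ← Real.exp_add]; push_cast; ring_nf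
        _ ≤ _ :=
            mul_le_mul (exp_bounds (hb m u v)).2 (ih u).2 (Real.exp_pos _).le (Real.exp_pos _).le

lemma log_hR_growth {E : Type*} [Fintype E] [Nonempty E] (b : ℕ → E → E → ℝ) (t B : ℝ)
    (hb : ∀ j u v, |b j u v| ≤ B) (m : ℕ) (v : E) :
    |Real.log (hR b t m v)| ≤ m * (|t| * B) := by
  have h := hR_growth b t B hb m v
  rw [abs_le]
  exact ⟨(Real.le_log_iff_exp_le (hR_pos _ _ _ _)).2 h.2,
    (Real.log_le_iff_le_exp (hR_pos _ _ _ _)).2 h.1⟩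

lemma log_hR_integrable {E Ω : Type*} [Fintype E] [MeasurableSpace Ω] (P : Measure Ω)
    [IsProbabilityMeasure P] (s : E) (b : Ω → ℕ → E → E → ℝ)
    (hbm : ∀ j u v, Measurable fun ω => b ω j u v) (B : ℝ)
    (hb : ∀ ω j u v, |b ω j u v| ≤ B) (t : ℝ) (m : ℕ) :
    Integrable (fun ω => Real.log (hR (b ω) t m s)) P := by
  have : Nonempty E := ⟨s⟩
  exact Integrable.of_bound (hR_measurable b hbm t m s).log.aestronglyMeasurable
    (m * (|t| * B)) (Eventually.of_forall fun ω => log_hR_growth (b ω) t B (hb ω) m s)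

lemma abstract_limit {E Ω : Type*} [Fintype E] [MeasurableSpace Ω] (P : Measure Ω)
    [IsProbabilityMeasure P] (τ : Ω → Ω) (hτ : MeasurePreserving τ P P)
    (s : E) (b : Ω → ℕ → E → E → ℝ)
    (hbm : ∀ j u v, Measurable fun ω => b ω j u v) (B : ℝ) (hB : 0 ≤ B)
    (hb : ∀ ω j u v, |b ω j u v| ≤ B)
    (hshift : ∀ ω m j, b ω (m + j) = b (τ^[m] ω) j) (t : ℝ) :
    ∃ l : ℝ, Tendsto (fun m : ℕ => (∫ ω, Real.log (hR (b ω) t m s) ∂P) / m) atTop (𝓝 l) := by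
  have : Nonempty E := ⟨s⟩
  set A : ℕ → ℝ := fun m => ∫ ω, Real.log (hR (b ω) t m s) ∂P with hA
  set c : ℝ := 2 * (|t| * B) with hc
  have hc0 : 0 ≤ c := by positivity
  have hsub : Subadditive (fun m => A m + c) := by
    intro m n
    have h1 : ∀ ω, Real.log (hR (b ω) t (m + n) s) ≤
        c + Real.log (hR (b ω) t m s) + Real.log (hR (b (τ^[m] ω)) t n s) := by
      intro ω
      have h2 := hR_submul (b ω) t m _ (fun u => hR_comparable (b ω) t B hB (hb ω) m u s) n s
      have h3 : (fun j => b ω (m + j)) = b (τ^[m] ω) := funext fun j => hshift ω m j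
      rw [h3] at h2
      have p1 := hR_pos (b ω) t m s
      have p2 := hR_pos (b (τ^[m] ω)) t n s
      have h4 := Real.log_le_log (hR_pos _ _ _ _) h2
      rw [Real.log_mul (by positivity) p2.ne', Real.log_mul (by positivity) p1.ne', Real.log_pow,
        Real.log_exp] at h4
      simpa [hc] using h4
    have hi := log_hR_integrable P s b hbm B hb t
    have hcomp : Integrable (fun ω => Real.log (hR (b (τ^[m] ω)) t n s)) P :=
      (hτ.iterate m).integrable_comp_of_integrable (hi n)
    have hce : ∫ ω, Real.log (hR (b (τ^[m] ω)) t n s) ∂P = A n := by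
      have := integral_map (μ := P) (φ := τ^[m]) (hτ.iterate m).measurable.aemeasurable
        (f := fun ω => Real.log (hR (b ω) t n s))
        (hR_measurable b hbm t n s).log.aestronglyMeasurable
      rw [(hτ.iterate m).map_eq] at this
      exact this.symm
    have h5 := integral_mono (hi (m + n)) (((integrable_const c).add (hi m)).add hcomp) h1
    have h6 : ∫ ω, (c + Real.log (hR (b ω) t m s) + Real.log (hR (b (τ^[m] ω)) t n s)) ∂P
        = c + A m + A n := by
      have hcm : Integrable (fun ω => c + Real.log (hR (b ω) t m s)) P :=
        (integrable_const c).add (hi m)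
      rw [integral_add hcm hcomp,
        integral_add (integrable_const c) (hi m), hce]
      simp [hA]
    have h7 : A (m + n) ≤ c + A m + A n := by rw [← h6]; exact h5
    simp only
    linarith
  have hlow : ∀ m : ℕ, -(m * (|t| * B)) ≤ A m := by
    intro m
    have := norm_integral_le_of_norm_le_const (μ := P) (C := m * (|t| * B))
      (f := fun ω => Real.log (hR (b ω) t m s))
      (Eventually.of_forall fun ω => log_hR_growth (b ω) t B (hb ω) m s)
    rw [Real.norm_eq_abs] at this
    simp only [probReal_univ, mul_one] at this
    exact (abs_le.1 this).1
  have hbdd : BddBelow (Set.range fun n : ℕ => (A n + c) / n) := by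
    refine ⟨-(|t| * B), ?_⟩
    rintro _ ⟨n, rfl⟩
    rcases Nat.eq_zero_or_pos n with rfl | hn
    · simp; positivity
    · have hn' : (0 : ℝ) < n := by exact_mod_cast hn
      simp only
      rw [le_div_iff₀ hn']
      linarith [hlow n]
  refine ⟨hsub.lim, ?_⟩
  have h1 := hsub.tendsto_lim hbdd
  have h2 : Tendsto (fun n : ℕ => c / n) atTop (𝓝 0) := tendsto_const_div_atTop_nhds_zero_nat c
  have h3 := h1.sub h2
  rw [sub_zero] at h3
  refine h3.congr fun n => ?_
  ring

lemma ratio_ofReal_pos {E : Type*} [Fintype E] (s : E) (b : ℕ → E → E → ℝ) (t0 t : ℝ) (j : ℕ) :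
    Complex.log (ratio s b t0 j t) =
      ((Real.log (hR b t (j + 1) s) - Real.log (hR b t0 (j + 1) s)
        - (Real.log (hR b t j s) - Real.log (hR b t0 j s)) : ℝ) : ℂ) := by
  have : Nonempty E := ⟨s⟩
  have p := hR_pos b t
  have p0 := hR_pos b t0
  have e : ratio s b t0 j t =
      (((hR b t (j + 1) s / hR b t0 (j + 1) s) / (hR b t j s / hR b t0 j s) : ℝ) : ℂ) := by
    simp only [ratio, gC_ofReal]
    push_cast
    rfl
  rw [e, ← Complex.ofReal_log (by
    have := p (j + 1) s; have := p0 (j + 1) s; have := p j s; have := p0 j s; positivity)]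
  congr 1
  rw [Real.log_div (div_pos (p _ _) (p0 _ _)).ne' (div_pos (p _ _) (p0 _ _)).ne',
    Real.log_div (p _ _).ne' (p0 _ _).ne', Real.log_div (p _ _).ne' (p0 _ _).ne']

lemma abstract_analytic {E Ω : Type*} [Fintype E] [MeasurableSpace Ω] (P : Measure Ω)
    [IsProbabilityMeasure P] (s : E) (b : Ω → ℕ → E → E → ℝ)
    (hbm : ∀ j u v, Measurable fun ω => b ω j u v) (B : ℝ) (hB : 0 ≤ B)
    (hb : ∀ ω j u v, |b ω j u v| ≤ B) (ψ : ℝ → ℝ)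
    (hψ : ∀ t, Tendsto (fun m : ℕ => (∫ ω, Real.log (hR (b ω) t m s) ∂P) / m) atTop (𝓝 (ψ t)))
    (t0 : ℝ) : AnalyticAt ℝ ψ t0 := by
  have : Nonempty E := ⟨s⟩
  obtain ⟨ε, hε, hrb⟩ := ratio_bound s t0 B hB
  have hbd : ∀ j ω, ∀ z ∈ Metric.ball (t0 : ℂ) ε, ‖Complex.log (ratio s (b ω) t0 j z)‖ ≤ 1 := by
    intro j ω z hz
    rw [Metric.mem_ball, dist_eq_norm] at hz
    have h := (hrb (b ω) (hb ω) z hz j).2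
    have h2 := Complex.norm_log_one_add_half_le_self h
    rw [add_sub_cancel] at h2
    linarith
  have hmeas : ∀ j z, Measurable fun ω => Complex.log (ratio s (b ω) t0 j z) := by
    intro j z
    refine Measurable.clog ?_
    simp only [ratio]
    have h1 := gC_measurable b hbm z (j + 1) s
    have h2 := gC_measurable b hbm z j s
    have h3 := hR_measurable b hbm t0 (j + 1) s
    have h4 := hR_measurable b hbm t0 j s
    exact (h1.div (Complex.measurable_ofReal.comp h3)).div
      (h2.div (Complex.measurable_ofReal.comp h4))
  have hdiff : ∀ j ω, DifferentiableOn ℂ (fun z => Complex.log (ratio s (b ω) t0 j z))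
      (Metric.ball (t0 : ℂ) ε) := by
    intro j ω z hz
    rw [Metric.mem_ball, dist_eq_norm] at hz
    have h := hrb (b ω) (hb ω) z hz
    have n1 : ((hR (b ω) t0 j s : ℝ) : ℂ) ≠ 0 := by exact_mod_cast (hR_pos (b ω) t0 j s).ne'
    have hd : DifferentiableAt ℂ (fun z => ratio s (b ω) t0 j z) z := by
      simp only [ratio]
      refine DifferentiableAt.div ?_ ?_ (div_ne_zero (h j).1 n1)
      · exact (gC_differentiable (b ω) (j + 1) s z).div_const _
      · exact (gC_differentiable (b ω) j s z).div_const _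
    refine (hd.clog ?_).differentiableWithinAt
    have := Complex.mem_slitPlane_of_norm_lt_one (z := ratio s (b ω) t0 j z - 1)
      ((h j).2.trans_lt (by norm_num))
    rwa [add_sub_cancel] at this
  set F : ℕ → ℂ → ℂ := fun m z =>
    (∑ j ∈ Finset.range m, ∫ ω, Complex.log (ratio s (b ω) t0 j z) ∂P) / m with hF
  have key : AnalyticAt ℝ (fun t => ψ t - ψ t0) t0 := by
    refine vitali (F := F) (C := 1) hε ?_ ?_ ?_
    · intro m
      simp only [hF]
      refine DifferentiableOn.div_const (DifferentiableOn.fun_sum fun j _ => ?_) _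
      exact differentiableOn_integral P (hmeas j) (hdiff j) (hbd j)
    · intro m z hz
      simp only [hF, norm_div, Complex.norm_natCast]
      refine div_le_one_of_le₀ ?_ (by positivity)
      refine (norm_sum_le _ _).trans ?_
      calc _ ≤ ∑ _j ∈ Finset.range m, (1 : ℝ) := by
            refine Finset.sum_le_sum fun j _ => ?_
            have := norm_integral_le_of_norm_le_const (μ := P) (C := 1)
              (Eventually.of_forall fun ω => hbd j ω z hz)
            simpa using this
        _ = m := by simp
    · intro t ht
      refine ((hψ t).sub (hψ t0)).congr fun m => ?_
      have hi := log_hR_integrable P s b hbm B hb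
      have e1 : ∀ j, ∫ ω, Complex.log (ratio s (b ω) t0 j t) ∂P
          = (((∫ ω, Real.log (hR (b ω) t (j + 1) s) ∂P - ∫ ω, Real.log (hR (b ω) t0 (j + 1) s) ∂P)
            - (∫ ω, Real.log (hR (b ω) t j s) ∂P - ∫ ω, Real.log (hR (b ω) t0 j s) ∂P) : ℝ) : ℂ) := by
        intro j
        simp only [ratio_ofReal_pos]
        have hdi : ∀ i, Integrable
            (fun ω => Real.log (hR (b ω) t i s) - Real.log (hR (b ω) t0 i s)) P :=
          fun i => (hi t i).sub (hi t0 i)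
        rw [integral_complex_ofReal, integral_sub (hdi _) (hdi _),
          integral_sub (hi t _) (hi t0 _), integral_sub (hi t _) (hi t0 _)]
      simp only [hF, e1]
      rw [← Complex.ofReal_sum, ← Complex.ofReal_natCast, ← Complex.ofReal_div, Complex.ofReal_re,
        Finset.sum_range_sub (fun j => ∫ ω, Real.log (hR (b ω) t j s) ∂P -
          ∫ ω, Real.log (hR (b ω) t0 j s) ∂P)]
      simp [hR, sub_div]
  have := key.add (analyticAt_const (v := ψ t0))
  refine this.congr (Eventually.of_forall fun t => ?_)
  simp
/-! ### Cylinder structure of the Bernoulli measure -/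

/-- Prepend a letter. -/
def pre {S : Type*} (s : S) (y : ℕ → S) : ℕ → S
  | 0 => s
  | n + 1 => y n

/-- Prepend a word. -/
def cat {S : Type*} : (l : ℕ) → (Fin l → S) → (ℕ → S) → ℕ → S
  | 0, _, y => y
  | l + 1, u, y => pre (u 0) (cat l (Fin.tail u) y)

lemma cat_lt {S : Type*} (l : ℕ) (u : Fin l → S) (y : ℕ → S) (i : Fin l) :
    cat l u y i = u i := by
  induction l with
  | zero => exact i.elim0
  | succ l ih =>
    refine Fin.cases ?_ (fun i => ?_) i
    · rfl
    · exact ih (Fin.tail u) i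

lemma cat_add {S : Type*} (l : ℕ) (u : Fin l → S) (y : ℕ → S) (n : ℕ) :
    cat l u y (l + n) = y n := by
  induction l with
  | zero => simp [cat]
  | succ l ih =>
    rw [Nat.succ_add]
    exact ih (Fin.tail u)

lemma shift_iterate {S : Type*} (k n : ℕ) (x : ℕ → S) : (shift^[k] x) n = x (k + n) := by
  induction k generalizing x with
  | zero => simp
  | succ k ih =>
    rw [Function.iterate_succ_apply, ih]
    simp only [shift]
    congr 1
    ring

lemma shift_cat {S : Type*} (l : ℕ) (u : Fin l → S) (y : ℕ → S) :
    shift^[l] (cat l u y) = y := by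
  funext n
  rw [shift_iterate, cat_add]

lemma shift_continuous {S : Type*} [TopologicalSpace S] : Continuous (shift : (ℕ → S) → ℕ → S) :=
  continuous_pi fun n => continuous_apply (n + 1)

lemma pre_continuous {S : Type*} [TopologicalSpace S] (s : S) : Continuous (pre s) := by
  refine continuous_pi fun n => ?_
  cases n with
  | zero => exact continuous_const
  | succ n => exact continuous_apply n

lemma cyl_measurable {S : Type*} [MeasurableSpace S] [MeasurableSingletonClass S] {m : ℕ}
    (a : Fin m → S) : MeasurableSet (cyl a) := by
  have : cyl a = ⋂ i : Fin m, (fun y : ℕ → S => y i) ⁻¹' {a i} := by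
    ext y; simp [cyl]
  rw [this]
  exact MeasurableSet.iInter fun i => measurable_pi_apply _ (measurableSet_singleton _)

lemma measure_ext_cyl {S : Type*} [Fintype S] [MeasurableSpace S] [MeasurableSingletonClass S]
    (μ ν : Measure (ℕ → S)) [IsFiniteMeasure μ]
    (h : ∀ (m : ℕ) (a : Fin m → S), μ (cyl a) = ν (cyl a)) : μ = ν := by
  classical
  set C : Set (Set (ℕ → S)) := {A | A = ∅ ∨ ∃ (m : ℕ) (a : Fin m → S), A = cyl a} with hC
  refine ext_of_generate_finite C ?_ ?_ ?_ ?_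
  · refine le_antisymm ?_ ?_
    · rw [MeasurableSpace.pi]
      refine iSup_le fun n => ?_
      rw [← measurable_iff_comap_le]
      refine @measurable_to_countable' _ _ _ _ (MeasurableSpace.generateFrom C) _ fun s => ?_
      have : (fun x : ℕ → S => x n) ⁻¹' {s}
          = ⋃ a : {a : Fin (n + 1) → S // a (Fin.last n) = s}, cyl a.1 := by
        ext x
        simp only [Set.mem_preimage, Set.mem_singleton_iff, Set.mem_iUnion]
        constructor
        · intro hx
          exact ⟨⟨fun i => x i, by simpa using hx⟩, fun i => rfl⟩
        · rintro ⟨a, ha⟩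
          have := ha (Fin.last n)
          rw [a.2] at this
          simpa using this
      rw [this]
      exact @MeasurableSet.iUnion _ _ (MeasurableSpace.generateFrom C) _ _ fun a =>
        MeasurableSpace.measurableSet_generateFrom (Or.inr ⟨_, _, rfl⟩)
    · refine MeasurableSpace.generateFrom_le ?_
      rintro A (rfl | ⟨m, a, rfl⟩)
      · exact MeasurableSet.empty
      · exact cyl_measurable a
  · have aux : ∀ (m n : ℕ) (a : Fin m → S) (c : Fin n → S), m ≤ n → (cyl a ∩ cyl c).Nonempty →
        cyl a ∩ cyl c = cyl c := by
      rintro m n a c hmn ⟨x, hx1, hx2⟩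
      refine Set.inter_eq_right.2 fun y hy i => ?_
      have h1 := hx2 (Fin.castLE hmn i)
      have h2 := hy (Fin.castLE hmn i)
      have h3 := hx1 i
      simp only [Fin.val_castLE] at h1 h2
      rw [h2, ← h1, h3]
    rintro A (rfl | ⟨m, a, rfl⟩) B (rfl | ⟨n, c, rfl⟩) hne
    · simp at hne
    · simp at hne
    · simp at hne
    · rcases le_total m n with hmn | hmn
      · rw [aux m n a c hmn hne]; exact Or.inr ⟨n, c, rfl⟩
      · rw [Set.inter_comm] at hne ⊢
        rw [aux n m c a hmn hne]; exact Or.inr ⟨m, a, rfl⟩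
  · rintro A (rfl | ⟨m, a, rfl⟩)
    · simp
    · exact h m a
  · have : (Set.univ : Set (ℕ → S)) = cyl (Fin.elim0 : Fin 0 → S) := by
      ext y; simp [cyl]
    rw [this]; exact h _ _

lemma cont_integrable {S : Type*} [Fintype S] [TopologicalSpace S]
    [DiscreteTopology S] [MeasurableSpace S] [BorelSpace S]
    (σ : Measure (ℕ → S)) [IsProbabilityMeasure σ] {G : (ℕ → S) → ℝ} (hG : Continuous G) :
    Integrable G σ := by
  obtain ⟨C, hC⟩ := isCompact_univ.exists_bound_of_continuousOn hG.continuousOn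
  exact Integrable.of_bound hG.measurable.aestronglyMeasurable C
    (Eventually.of_forall fun x => hC x (Set.mem_univ x))

lemma integral_pre {S : Type*} [Fintype S] [TopologicalSpace S]
    [DiscreteTopology S] [MeasurableSpace S] [BorelSpace S] [Nonempty S]
    (σ : Measure (ℕ → S)) [IsProbabilityMeasure σ]
    (hσ : ∀ (m : ℕ) (a : Fin m → S), σ (cyl a) = (Fintype.card S : ℝ≥0∞)⁻¹ ^ m)
    {G : (ℕ → S) → ℝ} (hG : Continuous G) :
    ∫ x, G x ∂σ = (Fintype.card S : ℝ)⁻¹ * ∑ s, ∫ x, G (pre s x) ∂σ := by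
  classical
  have hinv : σ = (Fintype.card S : ℝ≥0∞)⁻¹ • ∑ s : S, σ.map (pre s) := by
    refine measure_ext_cyl _ _ fun m a => ?_
    rw [Measure.smul_apply, Measure.finsetSum_apply, smul_eq_mul]
    have hmap : ∀ s, σ.map (pre s) (cyl a) = σ (pre s ⁻¹' cyl a) := fun s =>
      Measure.map_apply (pre_continuous s).measurable (cyl_measurable a)
    simp only [hmap]
    cases m with
    | zero =>
      have : ∀ s : S, pre s ⁻¹' cyl a = Set.univ := fun s => by
        ext y; simp [cyl]
      simp only [this, measure_univ, Finset.sum_const, Finset.card_univ, hσ, pow_zero,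
        nsmul_eq_mul, mul_one]
      rw [ENNReal.inv_mul_cancel] <;> simp
    | succ m =>
      have : ∀ s : S, σ (pre s ⁻¹' cyl a) =
          if s = a 0 then (Fintype.card S : ℝ≥0∞)⁻¹ ^ m else 0 := fun s => by
        split_ifs with h
        · rw [← hσ m (Fin.tail a)]
          congr 1
          ext y
          simp only [cyl, Set.mem_preimage, Set.mem_ofPred_eq, Fin.forall_fin_succ]
          constructor
          · exact fun hy i => hy.2 i
          · exact fun hy => ⟨h, hy⟩
        · have : pre s ⁻¹' cyl a = ∅ := by
            ext y
            simp only [cyl, Set.mem_preimage, Set.mem_ofPred_eq, Fin.forall_fin_succ,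
              Set.mem_empty_iff_false, iff_false]
            exact fun hy => h hy.1
          rw [this, measure_empty]
      simp only [this, Finset.sum_ite_eq', Finset.mem_univ, if_true, hσ]
      rw [pow_succ']
  have h1 : ∫ x, G x ∂σ = ∫ x, G x ∂((Fintype.card S : ℝ≥0∞)⁻¹ • ∑ s : S, σ.map (pre s)) := by
    rw [← hinv]
  rw [h1, integral_smul_measure, integral_finsetSum_measure]
  · simp only [ENNReal.toReal_inv, ENNReal.toReal_natCast, smul_eq_mul]
    congr 1
    refine Finset.sum_congr rfl fun s _ => ?_
    rw [integral_map (pre_continuous s).measurable.aemeasurable hG.measurable.aestronglyMeasurable]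
  · intro s _
    rw [integrable_map_measure hG.measurable.aestronglyMeasurable
      (pre_continuous s).measurable.aemeasurable]
    exact cont_integrable σ (hG.comp (pre_continuous s))

lemma integral_cat {S : Type*} [Fintype S] [TopologicalSpace S]
    [DiscreteTopology S] [MeasurableSpace S] [BorelSpace S] [Nonempty S]
    (σ : Measure (ℕ → S)) [IsProbabilityMeasure σ]
    (hσ : ∀ (m : ℕ) (a : Fin m → S), σ (cyl a) = (Fintype.card S : ℝ≥0∞)⁻¹ ^ m)
    (l : ℕ) {G : (ℕ → S) → ℝ} (hG : Continuous G) :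
    ∫ x, G x ∂σ = ((Fintype.card S : ℝ) ^ l)⁻¹ * ∑ u : Fin l → S, ∫ x, G (cat l u x) ∂σ := by
  induction l generalizing G with
  | zero => simp [cat]
  | succ l ih =>
    rw [integral_pre σ hσ hG]
    have h1 : ∀ s : S, ∫ x, G (pre s x) ∂σ = ((Fintype.card S : ℝ) ^ l)⁻¹ *
        ∑ u : Fin l → S, ∫ x, G (pre s (cat l u x)) ∂σ := fun s =>
      ih (hG.comp (pre_continuous s))
    simp only [h1, ← Finset.mul_sum]
    rw [← mul_assoc, ← mul_inv, ← pow_succ']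
    congr 1
    rw [← Fintype.sum_prod_type']
    refine Fintype.sum_equiv (Fin.consEquiv fun _ => S) _ _ fun x => ?_
    simp [cat, Fin.consEquiv]

/-- Block energies. -/
def blk {S : Type*} (r : ℕ) (f : (ℕ → S) → ℝ) (y0 : ℕ → S) (w : ℕ → ℝ) (j : ℕ)
    (u v : Fin r → S) : ℝ :=
  ∑ i ∈ Finset.range r, w (r * j + i) * f (shift^[i] (cat r u (cat r v y0)))

lemma blk_cat {S : Type*} (r : ℕ) (f : (ℕ → S) → ℝ)
    (hfr : ∀ x y : ℕ → S, (∀ i, i < r → x i = y i) → f x = f y) (y0 : ℕ → S) (w : ℕ → ℝ) (j : ℕ)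
    (u : Fin r → S) (y : ℕ → S) :
    ∑ i ∈ Finset.range r, w (r * j + i) * f (shift^[i] (cat r u y))
      = blk r f y0 w j u (fun i => y i) := by
  refine Finset.sum_congr rfl fun i hi => ?_
  rw [Finset.mem_range] at hi
  congr 1
  refine hfr _ _ fun n hn => ?_
  rw [shift_iterate, shift_iterate]
  rcases lt_or_ge (i + n) r with h | h
  · have h1 := cat_lt r u y ⟨i + n, h⟩
    have h2 := cat_lt r u (cat r (fun i => y i) y0) ⟨i + n, h⟩
    simp only at h1 h2
    rw [h1, h2]
  · obtain ⟨p, hp⟩ := Nat.exists_eq_add_of_le h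
    rw [hp, cat_add, cat_add]
    have hpr : p < r := by omega
    exact (cat_lt r (fun i => y i) y0 ⟨p, hpr⟩).symm

lemma block_identity {S : Type*} [Fintype S] [TopologicalSpace S]
    [DiscreteTopology S] [MeasurableSpace S] [BorelSpace S] [Nonempty S]
    (σ : Measure (ℕ → S)) [IsProbabilityMeasure σ]
    (hσ : ∀ (m : ℕ) (a : Fin m → S), σ (cyl a) = (Fintype.card S : ℝ≥0∞)⁻¹ ^ m)
    (r : ℕ) (f : (ℕ → S) → ℝ) (hfc : Continuous f)
    (hfr : ∀ x y : ℕ → S, (∀ i, i < r → x i = y i) → f x = f y) (y0 : ℕ → S) (w : ℕ → ℝ)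
    (t : ℝ) (m : ℕ) (Φ : (ℕ → S) → ℝ) (hΦ : Continuous Φ) :
    ∫ x, Real.exp (t * ∑ k ∈ Finset.range (r * m), w k * f (shift^[k] x)) * Φ (shift^[r * m] x) ∂σ
      = ∫ y, hR (blk r f y0 w) t m (fun i => y i) * Φ y ∂σ := by
  induction m generalizing Φ with
  | zero => simp [hR]
  | succ m ih =>
    have hsc : ∀ k, Continuous (shift^[k] : (ℕ → S) → ℕ → S) := fun k => shift_continuous.iterate k
    set Φ' : (ℕ → S) → ℝ := fun x =>
      Real.exp (t * ∑ i ∈ Finset.range r, w (r * m + i) * f (shift^[i] x)) * Φ (shift^[r] x)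
      with hΦ'
    have hΦ'c : Continuous Φ' := by
      refine Continuous.mul (Real.continuous_exp.comp (continuous_const.mul
        (continuous_finsetSum _ fun i _ => continuous_const.mul (hfc.comp (hsc i)))))
        (hΦ.comp (hsc r))
    have hres : ∀ (H : (Fin r → S) → ℝ), Continuous fun y : ℕ → S => H (fun i => y i) := fun H =>
      (continuous_of_discreteTopology (f := H)).comp (continuous_pi fun i => continuous_apply _)
    have h1 : ∀ x, Real.exp (t * ∑ k ∈ Finset.range (r * (m + 1)), w k * f (shift^[k] x))
        * Φ (shift^[r * (m + 1)] x)
        = Real.exp (t * ∑ k ∈ Finset.range (r * m), w k * f (shift^[k] x))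
          * Φ' (shift^[r * m] x) := by
      intro x
      simp only [hΦ']
      rw [mul_add, mul_one, Finset.sum_range_add, mul_add, Real.exp_add, mul_assoc,
        Nat.add_comm (r * m) r, Function.iterate_add_apply]
      congr 4
      refine Finset.sum_congr rfl fun i _ => ?_
      rw [Nat.add_comm (r * m) i, Function.iterate_add_apply]
    simp only [h1]
    rw [ih Φ' hΦ'c, integral_cat σ hσ r
      (G := fun y => hR (blk r f y0 w) t m (fun i => y i) * Φ' y) ((hres _).mul hΦ'c)]
    have h2 : ∀ (u : Fin r → S) (y : ℕ → S),
        hR (blk r f y0 w) t m (fun i => cat r u y i) * Φ' (cat r u y)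
        = Real.exp (t * blk r f y0 w m u (fun i => y i)) * hR (blk r f y0 w) t m u * Φ y := by
      intro u y
      have h3 : (fun i : Fin r => cat r u y i) = u := funext fun i => cat_lt r u y i
      simp only [hΦ']
      rw [h3, blk_cat r f hfr y0 w m u y, shift_cat]
      ring
    simp only [h2]
    rw [← integral_finsetSum, ← integral_const_mul]
    · refine integral_congr_ae (Eventually.of_forall fun y => ?_)
      simp only [hR]
      rw [Fintype.card_fun, Fintype.card_fin, Finset.mul_sum, Finset.mul_sum, Finset.sum_mul]
      push_cast
      refine Finset.sum_congr rfl fun u _ => ?_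
      ring
    · intro u _
      exact cont_integrable σ ((hres (fun v => Real.exp (t * blk r f y0 w m u v) *
        hR (blk r f y0 w) t m u)).mul hΦ)
lemma Z_compare {S : Type*} [Fintype S] [TopologicalSpace S]
    [DiscreteTopology S] [MeasurableSpace S] [BorelSpace S] [Nonempty S]
    (σ : Measure (ℕ → S)) [IsProbabilityMeasure σ]
    (hσ : ∀ (m : ℕ) (a : Fin m → S), σ (cyl a) = (Fintype.card S : ℝ≥0∞)⁻¹ ^ m)
    (r : ℕ) (hr : 1 ≤ r) (f : (ℕ → S) → ℝ) (hfc : Continuous f)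
    (hfr : ∀ x y : ℕ → S, (∀ i, i < r → x i = y i) → f x = f y) (y0 : ℕ → S) (w : ℕ → ℝ)
    (M F : ℝ) (hM : 0 ≤ M) (hF : 0 ≤ F) (hw : ∀ k, |w k| ≤ M) (hf : ∀ x, |f x| ≤ F)
    (hblk : ∀ j u v, |blk r f y0 w j u v| ≤ r * (M * F))
    (t : ℝ) (s : Fin r → S) (n : ℕ) :
    |Real.log (∫ x, Real.exp (t * ∑ k ∈ Finset.range n, w k * f (shift^[k] x)) ∂σ)
      - Real.log (hR (blk r f y0 w) t (n / r) s)| ≤ 3 * (|t| * (r * (M * F))) := by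
  set m := n / r with hm
  set B : ℝ := r * (M * F) with hB
  have hB0 : 0 ≤ B := by positivity
  have hn : n = r * m + n % r := (Nat.div_add_mod n r).symm
  have hmod : n % r < r := Nat.mod_lt _ hr
  have hsc : ∀ k, Continuous (shift^[k] : (ℕ → S) → ℕ → S) := fun k => shift_continuous.iterate k
  have hcont : ∀ n : ℕ, Continuous fun x : ℕ → S =>
      Real.exp (t * ∑ k ∈ Finset.range n, w k * f (shift^[k] x)) := fun n =>
    Real.continuous_exp.comp (continuous_const.mul
        (continuous_finsetSum _ fun i _ => continuous_const.mul (hfc.comp (hsc i))))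
  have hint := fun n => cont_integrable σ (hcont n)
  set Z : ℕ → ℝ := fun n =>
    ∫ x, Real.exp (t * ∑ k ∈ Finset.range n, w k * f (shift^[k] x)) ∂σ with hZ
  have hrem : ∀ x : ℕ → S, |t * ∑ i ∈ Finset.range (n % r),
      w (r * m + i) * f (shift^[r * m + i] x)| ≤ |t| * B := by
    intro x
    rw [abs_mul]
    refine mul_le_mul_of_nonneg_left ?_ (abs_nonneg _)
    refine (Finset.abs_sum_le_sum_abs _ _).trans ?_
    calc _ ≤ ∑ _i ∈ Finset.range (n % r), M * F := by
          refine Finset.sum_le_sum fun i _ => ?_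
          rw [abs_mul]
          exact mul_le_mul (hw _) (hf _) (abs_nonneg _) hM
      _ = ((n % r : ℕ) : ℝ) * (M * F) := by simp
      _ ≤ _ := by
          refine mul_le_mul_of_nonneg_right ?_ (by positivity)
          exact_mod_cast hmod.le
  have hsplit : ∀ x : ℕ → S, Real.exp (t * ∑ k ∈ Finset.range n, w k * f (shift^[k] x))
      = Real.exp (t * ∑ i ∈ Finset.range (n % r), w (r * m + i) * f (shift^[r * m + i] x))
        * Real.exp (t * ∑ k ∈ Finset.range (r * m), w k * f (shift^[k] x)) := by
    intro x
    rw [← Real.exp_add, ← mul_add]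
    conv_lhs => rw [hn, Finset.sum_range_add]
    rw [add_comm]
  have hZu : Z n ≤ Real.exp (|t| * B) * Z (r * m) := by
    simp only [hZ]
    rw [← integral_const_mul]
    refine integral_mono (hint n) ((hint (r * m)).const_mul _) fun x => ?_
    simp only [hsplit x]
    exact mul_le_mul_of_nonneg_right (Real.exp_le_exp.2 (abs_le.1 (hrem x)).2) (Real.exp_pos _).le
  have hZl : Real.exp (-(|t| * B)) * Z (r * m) ≤ Z n := by
    simp only [hZ]
    rw [← integral_const_mul]
    refine integral_mono ((hint (r * m)).const_mul _) (hint n) fun x => ?_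
    simp only [hsplit x]
    exact mul_le_mul_of_nonneg_right (Real.exp_le_exp.2 (abs_le.1 (hrem x)).1) (Real.exp_pos _).le
  have hid : Z (r * m) = ∫ y, hR (blk r f y0 w) t m (fun i => y i) ∂σ := by
    have := block_identity σ hσ r f hfc hfr y0 w t m (fun _ => 1) continuous_const
    simpa [hZ] using this
  have hhc : Integrable (fun y : ℕ → S => hR (blk r f y0 w) t m (fun i => y i)) σ :=
    cont_integrable σ ((continuous_of_discreteTopology (f := hR (blk r f y0 w) t m)).comp
      (continuous_pi fun i => continuous_apply _))
  have hpos := hR_pos (blk r f y0 w) t m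
  have hcmp := hR_comparable (blk r f y0 w) t B hB0 hblk m
  have hu : Z (r * m) ≤ Real.exp (|t| * B) ^ 2 * hR (blk r f y0 w) t m s := by
    rw [hid]
    have := integral_mono hhc (integrable_const _) (fun y => hcmp (fun i => y i) s)
    simpa using this
  have hl : hR (blk r f y0 w) t m s ≤ Real.exp (|t| * B) ^ 2 * Z (r * m) := by
    rw [hid, ← integral_const_mul]
    have := integral_mono (integrable_const _) (hhc.const_mul (Real.exp (|t| * B) ^ 2))
      (fun y => hcmp s (fun i => y i))
    simpa using this
  have hZp : 0 < Z (r * m) := by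
    by_contra hneg
    have : Real.exp (|t| * B) ^ 2 * Z (r * m) ≤ 0 :=
      mul_nonpos_of_nonneg_of_nonpos (by positivity) (not_lt.1 hneg)
    linarith [hpos s]
  have hZnp : 0 < Z n := lt_of_lt_of_le (mul_pos (Real.exp_pos _) hZp) hZl
  have l1 := Real.log_le_log hZnp hZu
  have l2 := Real.log_le_log (mul_pos (Real.exp_pos _) hZp) hZl
  have l3 := Real.log_le_log hZp hu
  have l4 := Real.log_le_log (hpos s) hl
  rw [Real.log_mul (Real.exp_pos _).ne' hZp.ne', Real.log_exp] at l1 l2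
  rw [Real.log_mul (by positivity) (hpos s).ne', Real.log_pow, Real.log_exp] at l3
  rw [Real.log_mul (by positivity) hZp.ne', Real.log_pow, Real.log_exp] at l4
  push_cast at l3 l4
  rw [abs_le]
  constructor <;> linarith

lemma Z_measurable {S Ω : Type*} [Fintype S] [TopologicalSpace S]
    [DiscreteTopology S] [MeasurableSpace S] [BorelSpace S] [MeasurableSpace Ω]
    (σ : Measure (ℕ → S)) [IsProbabilityMeasure σ] (f : (ℕ → S) → ℝ) (hfc : Continuous f)
    (Θ : Ω → Ω) (hΘ : Measurable Θ) (W : Ω → ℝ) (hWm : Measurable W) (lam : ℝ) (n : ℕ) :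
    Measurable fun ω => ∫ x, Real.exp
              (lam * ∑ k ∈ Finset.range n, W (Θ^[k] ω) * f (shift^[k] x)) ∂σ := by
  have hj : Measurable fun p : Ω × (ℕ → S) => Real.exp
      (lam * ∑ k ∈ Finset.range n, W (Θ^[k] p.1) * f (shift^[k] p.2)) := by
    refine Real.measurable_exp.comp (Measurable.const_mul
      (Finset.measurable_fun_sum _ fun k _ => ?_) _)
    refine Measurable.mul ?_ ?_
    · exact (hWm.comp (hΘ.iterate k)).comp measurable_fst
    · exact ((hfc.comp (shift_continuous.iterate k)).measurable).comp measurable_snd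
  exact (hj.stronglyMeasurable.integral_prod_right').measurable

/-- Stationary ergodic weights, finite-range potential: if moreover `f`
depends only on the coordinates `x_0, …, x_{r−1}`, then the pressure
`φ̃(λ) = lim (1/n) ∫ log Z_n(λ,ω) dP(ω)` is well defined and real-analytic on `ℝ`. -/
theorem stationary_ergodic_pressure_analytic {S Ω : Type*} [Fintype S] [TopologicalSpace S]
    [DiscreteTopology S] [MeasurableSpace S] [BorelSpace S] (hq : 2 ≤ Fintype.card S)
    (σ : Measure (ℕ → S)) [IsProbabilityMeasure σ]
    (hσ : ∀ (m : ℕ) (a : Fin m → S), σ (cyl a) = (Fintype.card S : ℝ≥0∞)⁻¹ ^ m)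
    [MeasurableSpace Ω] (P : Measure Ω) [IsProbabilityMeasure P]
    (Θ : Ω → Ω) (hΘ : Ergodic Θ P)
    (W : Ω → ℝ) (hWm : Measurable W) (MW : ℝ) (hWb : ∀ ω, |W ω| ≤ MW)
    (r : ℕ) (hr : 1 ≤ r) (f : (ℕ → S) → ℝ) (hfc : Continuous f)
    (hfr : ∀ x y : ℕ → S, (∀ i, i < r → x i = y i) → f x = f y) :
    ∃ φt : ℝ → ℝ,
      (∀ lam : ℝ,
        Tendsto (fun n : ℕ =>
            (∫ ω, Real.log (∫ x, Real.exp
              (lam * ∑ k ∈ Finset.range n, W (Θ^[k] ω) * f (shift^[k] x)) ∂σ) ∂P) / n)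
          atTop (𝓝 (φt lam))) ∧
      ∀ t : ℝ, AnalyticAt ℝ φt t := by
  have hcard : 0 < Fintype.card S := by omega
  have hSne : Nonempty S := Fintype.card_pos_iff.1 hcard
  let y0 : ℕ → S := fun _ => Classical.arbitrary S
  let s : Fin r → S := fun _ => Classical.arbitrary S
  obtain ⟨F, hF⟩ := (isCompact_univ (X := ℕ → S)).exists_bound_of_continuousOn hfc.continuousOn
  have hf : ∀ x, |f x| ≤ F := fun x => hF x (Set.mem_univ x)
  have hF0 : 0 ≤ F := (abs_nonneg _).trans (hf y0)
  set M := |MW| with hMdef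
  have hM : 0 ≤ M := abs_nonneg _
  have hW : ∀ ω, |W ω| ≤ M := fun ω => (hWb ω).trans (le_abs_self _)
  set B : ℝ := r * (M * F) with hBdef
  have hB : 0 ≤ B := by positivity
  let b : Ω → ℕ → (Fin r → S) → (Fin r → S) → ℝ := fun ω => blk r f y0 (fun k => W (Θ^[k] ω))
  have hbb : ∀ ω j u v, |b ω j u v| ≤ B := by
    intro ω j u v
    refine (Finset.abs_sum_le_sum_abs _ _).trans ?_
    calc _ ≤ ∑ _i ∈ Finset.range r, M * F := by
          refine Finset.sum_le_sum fun i _ => ?_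
          rw [abs_mul]
          exact mul_le_mul (hW _) (hf _) (abs_nonneg _) hM
      _ = _ := by simp [hBdef]
  have hΘm : Measurable Θ := hΘ.toMeasurePreserving.measurable
  have hbm : ∀ j u v, Measurable fun ω => b ω j u v := by
    intro j u v
    refine Finset.measurable_fun_sum _ fun i _ => ?_
    exact (hWm.comp (hΘm.iterate _)).mul_const _
  have hshift : ∀ ω m j, b ω (m + j) = b ((Θ^[r])^[m] ω) j := by
    intro ω m j
    funext u v
    refine Finset.sum_congr rfl fun i _ => ?_
    congr 1
    have e : r * (m + j) + i = (r * j + i) + r * m := by ring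
    rw [← Function.iterate_mul, e]
    simp only [Function.iterate_add_apply]
  have hlim := fun t => abstract_limit P (Θ^[r]) (hΘ.toMeasurePreserving.iterate r) s b hbm B hB hbb
    hshift t
  choose ψ hψ using hlim
  have hr0 : (0 : ℝ) < r := by exact_mod_cast hr
  refine ⟨fun t => ψ t * (r : ℝ)⁻¹, fun lam => ?_, fun t =>
    (abstract_analytic P s b hbm B hB hbb ψ hψ t).mul analyticAt_const⟩
  set C : ℝ := 3 * (|lam| * B) with hC
  set X : ℕ → Ω → ℝ := fun n ω => Real.log (∫ x, Real.exp
              (lam * ∑ k ∈ Finset.range n, W (Θ^[k] ω) * f (shift^[k] x)) ∂σ) with hX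
  set A : ℕ → ℝ := fun m => ∫ ω, Real.log (hR (b ω) lam m s) ∂P with hA
  have hcmp : ∀ n ω, |X n ω - Real.log (hR (b ω) lam (n / r) s)| ≤ C := fun n ω =>
    Z_compare σ hσ r hr f hfc hfr y0 (fun k => W (Θ^[k] ω)) M F hM hF0 (fun k => hW _) hf
      (hbb ω) lam s n
  have hXm : ∀ n, Measurable (X n) := fun n =>
    (Z_measurable σ f hfc Θ hΘm W hWm lam n).log
  have hAi := log_hR_integrable P s b hbm B hbb lam
  have hdi : ∀ n, Integrable (fun ω => X n ω - Real.log (hR (b ω) lam (n / r) s)) P := fun n =>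
    Integrable.of_bound ((hXm n).sub (hR_measurable b hbm lam (n / r) s).log).aestronglyMeasurable
      C (Eventually.of_forall fun ω => hcmp n ω)
  have hXe : ∀ n, ∫ ω, X n ω ∂P =
      A (n / r) + ∫ ω, (X n ω - Real.log (hR (b ω) lam (n / r) s)) ∂P := by
    intro n
    simp only [hA]
    rw [← integral_add (hAi (n / r)) (hdi n)]
    simp
  have hXb : ∀ n, |∫ ω, (X n ω - Real.log (hR (b ω) lam (n / r) s)) ∂P| ≤ C := by
    intro n
    have := norm_integral_le_of_norm_le_const (μ := P) (C := C)
      (f := fun ω => X n ω - Real.log (hR (b ω) lam (n / r) s))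
      (Eventually.of_forall fun ω => hcmp n ω)
    simpa using this
  have hdiv : Tendsto (fun n : ℕ => n / r) atTop atTop :=
    Nat.tendsto_div_const_atTop (by omega)
  have h1 : Tendsto (fun n : ℕ => A (n / r) / ((n / r : ℕ) : ℝ)) atTop (𝓝 (ψ lam)) :=
    (hψ lam).comp hdiv
  have h2 : Tendsto (fun n : ℕ => ((n / r : ℕ) : ℝ) / n) atTop (𝓝 ((r : ℝ)⁻¹)) := by
    have := (tendsto_nat_floor_mul_div_atTop (R := ℝ) (inv_nonneg.2 hr0.le)).comp
      tendsto_natCast_atTop_atTop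
    refine this.congr fun n => ?_
    simp only [Function.comp]
    congr 2
    rw [inv_mul_eq_div, Nat.floor_div_natCast, Nat.floor_natCast]
  have h3 : Tendsto (fun n : ℕ => (∫ ω, (X n ω - Real.log (hR (b ω) lam (n / r) s)) ∂P) / n)
      atTop (𝓝 0) := by
    refine squeeze_zero_norm (a := fun n : ℕ => C / n) (fun n => ?_)
      (tendsto_const_div_atTop_nhds_zero_nat C)
    rw [norm_div, Real.norm_eq_abs, Real.norm_natCast]
    exact div_le_div_of_nonneg_right (hXb n) (by positivity)
  have h4 := (h1.mul h2).add h3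
  rw [add_zero] at h4
  refine h4.congr' ?_
  filter_upwards [eventually_ge_atTop r] with n hn
  have hq0 : ((n / r : ℕ) : ℝ) ≠ 0 := by
    have : 0 < n / r := Nat.div_pos hn hr
    exact_mod_cast this.ne'
  rw [hXe n, add_div, div_mul_div_cancel₀ hq0]
end
end
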